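/- Integrality gap for QMA(2)-Honest: for every ε > 0 there exist constants c > 0, e ∈ ℕ and n₀ such that for every n ≥ n₀ there exist a natural number m ≤ √n·(log n)^e and a Hermitian matrix M acting on (ℂ^{n^m}) ⊗ (ℂ^{n^m}) with 0 ≼ M ≼ I, such that, defining for each x ∈ {−1,1}ⁿ the unit vector ψ_x ∈ ℝ^{n^m} with coordinates (ψ_x)_{(i₁,…,i_m)} = n^{−m/2}·x_{i₁}⋯x_{i_m} and the real number Ψ(x) = ⟨ψ_x ⊗ ψ_x, M (ψ_x ⊗ ψ_x)⟩, the following hold: (i) Ψ(x) ≤ ε for every x ∈ {−1,1}ⁿ; (ii) there exists a degree-⌈c·n⌉ pseudo-expectation E over ℝ[x₁,…,x_n] satisfying the Boolean constraints such that applying E to the polynomial Σ_{I,J,K,L ∈ [n]^m} n^{−2m}·Re(M_{(I,K),(J,L)})·x_{i₁}⋯x_{i_m}·x_{j₁}⋯x_{j_m}·x_{k₁}⋯x_{k_m}·x_{l₁}⋯x_{l_m} (which equals Ψ(x) on the cube) gives the value 1. -/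

import Mathlib

open MvPolynomial
open scoped ComplexOrder

/-- A Boolean (±1) assignment. -/
def IsPM {ι : Type*} (x : ι → ℝ) : Prop := ∀ i, x i = 1 ∨ x i = -1

/-- The honest witness vector: `(ψ_x)_{(i₁,…,i_m)} = n^{−m/2}·x_{i₁}⋯x_{i_m}`. -/
noncomputable def psiVec (n m : ℕ) (x : Fin n → ℝ) (I : Fin m → Fin n) : ℝ :=
  (Real.sqrt ((n : ℝ) ^ m))⁻¹ * ∏ r, x (I r)

/-- The tensor product `ψ_x ⊗ ψ_x` as a complex vector indexed by pairs of tuples. -/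
noncomputable def psiTensor (n m : ℕ) (x : Fin n → ℝ)
    (p : (Fin m → Fin n) × (Fin m → Fin n)) : ℂ :=
  ((psiVec n m x p.1 * psiVec n m x p.2 : ℝ) : ℂ)

/-- The acceptance probability `Ψ(x) = ⟨ψ_x ⊗ ψ_x, M (ψ_x ⊗ ψ_x)⟩` of the verifier
`M` on the honest product witness. -/
noncomputable def acceptProb (n m : ℕ)
    (M : Matrix ((Fin m → Fin n) × (Fin m → Fin n))
      ((Fin m → Fin n) × (Fin m → Fin n)) ℂ)
    (x : Fin n → ℝ) : ℝ :=
  (∑ p, ∑ q, (starRingEnd ℂ) (psiTensor n m x p) * M p q * psiTensor n m x q).re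

/-- The polynomial which on the cube agrees with `Ψ(x)`:
`Σ_{I,J,K,L} n^{−2m}·Re(M_{(I,K),(J,L)})·x_I·x_J·x_K·x_L`. -/
noncomputable def acceptPoly (n m : ℕ)
    (M : Matrix ((Fin m → Fin n) × (Fin m → Fin n))
      ((Fin m → Fin n) × (Fin m → Fin n)) ℂ) :
    MvPolynomial (Fin n) ℝ :=
  ∑ I : Fin m → Fin n, ∑ J : Fin m → Fin n, ∑ K : Fin m → Fin n, ∑ L : Fin m → Fin n,
    C (((n : ℝ) ^ (2 * m))⁻¹ * (M (I, K) (J, L)).re) *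
      ((∏ r, X (I r)) * (∏ r, X (J r)) * (∏ r, X (K r)) * (∏ r, X (L r)))

/-- The sign character of `ZMod 2`. -/
def zmodSign (z : ZMod 2) : ℝ := if z = 0 then 1 else -1

lemma zmodSign_zero : zmodSign 0 = 1 := by simp [zmodSign]

lemma zmodSign_add (z w : ZMod 2) : zmodSign (z + w) = zmodSign z * zmodSign w := by
  have h : ∀ z : ZMod 2, z = 0 ∨ z = 1 := by decide
  have h2 : (1 : ZMod 2) + 1 = 0 := by decide
  rcases h z with rfl | rfl <;> rcases h w with rfl | rfl <;> simp [zmodSign, h2]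

lemma zmodSign_mul_self (z : ZMod 2) : zmodSign z * zmodSign z = 1 := by
  unfold zmodSign; split_ifs <;> norm_num

/-- A kernel that is multiplicative along its support is positive semidefinite. -/
lemma sum_mul_kernel_nonneg {α : Type*} (s : Finset α) (G : α → α → ℝ)
    (hself : ∀ a ∈ s, G a a = 1) (hsymm : ∀ a ∈ s, ∀ b ∈ s, G a b = G b a)
    (hmul : ∀ a ∈ s, ∀ b ∈ s, ∀ c ∈ s, G a b ≠ 0 → G b c ≠ 0 → G a c = G a b * G b c)
    (p : α → ℝ) : 0 ≤ ∑ a ∈ s, ∑ b ∈ s, p a * p b * G a b := by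
  classical
  let N : α → ℝ := fun a => ((s.filter fun c => G a c ≠ 0).card : ℝ)
  have hNpos : ∀ a ∈ s, 0 < N a := fun a ha => by
    have : a ∈ s.filter fun c => G a c ≠ 0 := by simp [ha, hself a ha]
    exact Nat.cast_pos.2 (Finset.card_pos.2 ⟨a, this⟩)
  have hNeq : ∀ a ∈ s, ∀ c ∈ s, G a c ≠ 0 → N a = N c := by
    intro a ha c hc h
    have : (s.filter fun d => G a d ≠ 0) = s.filter fun d => G c d ≠ 0 := by
      refine Finset.filter_congr fun d hd => ⟨fun h' => ?_, fun h' => ?_⟩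
      · rw [hmul c hc a ha d hd (hsymm a ha c hc ▸ h) h']
        exact mul_ne_zero (hsymm a ha c hc ▸ h) h'
      · rw [hmul a ha c hc d hd h h']
        exact mul_ne_zero h h'
    simp only [N, this]
  have hfac : ∀ a ∈ s, ∀ b ∈ s, G a b = ∑ c ∈ s, (N c)⁻¹ * (G a c * G b c) := by
    intro a ha b hb
    by_cases hab : G a b = 0
    · rw [hab, eq_comm]
      refine Finset.sum_eq_zero fun c hc => ?_
      by_contra hne
      have h1 : G a c ≠ 0 := fun h => hne (by simp [h])
      have h2 : G c b ≠ 0 := fun h => hne (by simp [hsymm b hb c hc, h])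
      exact mul_ne_zero h1 h2 (hmul a ha c hc b hb h1 h2 ▸ hab)
    · have hterm : ∀ c ∈ s, (N c)⁻¹ * (G a c * G b c)
          = if G a c ≠ 0 then (N a)⁻¹ * G a b else 0 := by
        intro c hc
        split_ifs with h
        · have hbc : G c b ≠ 0 := by
            rw [hmul c hc a ha b hb (hsymm a ha c hc ▸ h) hab]
            exact mul_ne_zero (hsymm a ha c hc ▸ h) hab
          rw [hNeq a ha c hc h, hsymm b hb c hc, ← hmul a ha c hc b hb h hbc]
        · simp [not_not.1 h]
      rw [Finset.sum_congr rfl hterm, ← Finset.sum_filter, Finset.sum_const, nsmul_eq_mul,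
        ← mul_assoc]
      change _ = N a * (N a)⁻¹ * _
      rw [mul_inv_cancel₀ (hNpos a ha).ne', one_mul]
  have hsq : ∑ a ∈ s, ∑ b ∈ s, p a * p b * G a b
      = ∑ c ∈ s, (N c)⁻¹ * (∑ a ∈ s, p a * G a c) ^ 2 := by
    calc _ = ∑ a ∈ s, ∑ b ∈ s, ∑ c ∈ s, (N c)⁻¹ * ((p a * G a c) * (p b * G b c)) := by
          refine Finset.sum_congr rfl fun a ha => Finset.sum_congr rfl fun b hb => ?_
          rw [hfac a ha b hb, Finset.mul_sum]
          exact Finset.sum_congr rfl fun c _ => by ring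
      _ = ∑ c ∈ s, ∑ a ∈ s, ∑ b ∈ s, (N c)⁻¹ * ((p a * G a c) * (p b * G b c)) :=
          (Finset.sum_congr rfl fun a _ => Finset.sum_comm).trans Finset.sum_comm
      _ = _ := by
          refine Finset.sum_congr rfl fun c _ => ?_
          rw [sq, Finset.sum_mul_sum, Finset.mul_sum]
          exact Finset.sum_congr rfl fun a _ => by rw [Finset.mul_sum]
  rw [hsq]
  exact Finset.sum_nonneg fun c hc => mul_nonneg (inv_nonneg.2 (hNpos c hc).le) (sq_nonneg _)

/-- The exponent vector of a monomial modulo `2`. -/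
def parity {n : ℕ} : (Fin n →₀ ℕ) →+ (Fin n → ZMod 2) where
  toFun α i := (α i : ZMod 2)
  map_zero' := by ext; simp
  map_add' α β := by ext; simp

lemma parity_single {n : ℕ} (i : Fin n) : parity (Finsupp.single i 1) = Pi.single i 1 := by
  ext k
  simp only [parity, AddMonoidHom.coe_mk, ZeroHom.coe_mk, Finsupp.single_apply, Pi.single_apply,
    eq_comm (a := i)]
  split_ifs <;> simp

lemma hammingNorm_parity_le {n : ℕ} (α : Fin n →₀ ℕ) :
    hammingNorm (parity α) ≤ α.sum fun _ k => k := by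
  classical
  calc hammingNorm (parity α) ≤ α.support.card := by
        refine Finset.card_le_card fun i hi => ?_
        simp only [Finset.mem_filter, Finset.mem_univ, true_and] at hi
        rw [Finsupp.mem_support_iff]
        exact fun h => hi (by simp [parity, h])
    _ ≤ _ := by
        rw [Finset.card_eq_sum_ones]
        exact Finset.sum_le_sum fun i hi => Nat.one_le_iff_ne_zero.2 (Finsupp.mem_support_iff.1 hi)

lemma hammingNorm_add_le' {ι : Type*} [Fintype ι] (u v : ι → ZMod 2) :
    hammingNorm (u + v) ≤ hammingNorm u + hammingNorm v := by
  classical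
  refine (Finset.card_le_card fun i hi => ?_).trans (Finset.card_union_le _ _)
  simp only [Finset.mem_filter, Finset.mem_univ, true_and, Finset.mem_union, Pi.add_apply] at hi ⊢
  by_contra! h
  exact hi (by rw [h.1, h.2, add_zero])

/-- Grigoriev's pseudo-expectation of an expanding parity system. -/
theorem exists_pseudoExpectation {n D : ℕ} {J : Type*} [Fintype J]
    (B : (J → ZMod 2) →+ (Fin n → ZMod 2)) (φ : (J → ZMod 2) →+ ZMod 2)
    (hB : ∀ T, T ≠ 0 → hammingNorm T ≤ 2 * D → hammingNorm T ≤ hammingNorm (B T)) :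
    ∃ E : MvPolynomial (Fin n) ℝ →ₗ[ℝ] ℝ, E 1 = 1 ∧
      (∀ p : MvPolynomial (Fin n) ℝ, p.totalDegree ≤ D / 2 → 0 ≤ E (p ^ 2)) ∧
      (∀ (i : Fin n) (q : MvPolynomial (Fin n) ℝ), E ((X i ^ 2 - 1) * q) = 0) ∧
      ∀ (α : Fin n →₀ ℕ) (T : J → ZMod 2), hammingNorm T ≤ D → B T = parity α →
        E (monomial α 1) = zmodSign (φ T) := by
  classical
  let e : (Fin n → ZMod 2) → ℝ := fun v =>
    if h : ∃ T, hammingNorm T ≤ D ∧ B T = v then zmodSign (φ h.choose) else 0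
  have two : ∀ v : J → ZMod 2, v + v = 0 := fun v => by ext; exact CharTwo.add_self_eq_zero _
  have two' : ∀ v : Fin n → ZMod 2, v + v = 0 := fun v => by ext; exact CharTwo.add_self_eq_zero _
  have he : ∀ T, hammingNorm T ≤ D → e (B T) = zmodSign (φ T) := by
    intro T hT
    have h : ∃ T', hammingNorm T' ≤ D ∧ B T' = B T := ⟨T, hT, rfl⟩
    obtain ⟨h1, h2⟩ := h.choose_spec
    have : h.choose + T = 0 := by
      by_contra hne
      have hle : hammingNorm (h.choose + T) ≤ 2 * D := (hammingNorm_add_le' _ _).trans (by omega)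
      have := hB _ hne hle
      rw [map_add, h2, two', hammingNorm_zero, Nat.le_zero, hammingNorm_eq_zero] at this
      exact hne this
    have hT' : h.choose = T := by
      rw [← add_left_inj T, this, two]
    simp only [e, dif_pos h, hT']
  have he' : ∀ v, e v ≠ 0 → ∃ T, hammingNorm T ≤ D ∧ B T = v := fun v hv => by
    by_contra h
    exact hv (dif_neg h)
  have he0 : e 0 = 1 := by
    have := he 0 (by simp)
    rwa [map_zero, map_zero, zmodSign_zero] at this
  have hemul : ∀ u v, hammingNorm (u + v) ≤ D → e u ≠ 0 → e v ≠ 0 → e (u + v) = e u * e v := by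
    intro u v huv hu hv
    obtain ⟨S, hS, rfl⟩ := he' u hu
    obtain ⟨T, hT, rfl⟩ := he' v hv
    have hST : hammingNorm (S + T) ≤ D := by
      by_cases h0 : S + T = 0
      · simp [h0]
      · refine (hB _ h0 ((hammingNorm_add_le' _ _).trans (by omega))).trans ?_
        rwa [map_add]
    rw [he S hS, he T hT, ← map_add, he _ hST, map_add, zmodSign_add]
  let E : MvPolynomial (Fin n) ℝ →ₗ[ℝ] ℝ :=
    (basisMonomials (Fin n) ℝ).constr ℝ fun α => e (parity α)
  have hE : ∀ (α : Fin n →₀ ℕ) (c : ℝ), E (monomial α c) = c * e (parity α) := by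
    intro α c
    have h1 : E (monomial α 1) = e (parity α) := by
      have := (basisMonomials (Fin n) ℝ).constr_basis ℝ (fun α => e (parity α)) α
      rwa [coe_basisMonomials] at this
    rw [← mul_one c, ← smul_eq_mul, ← smul_monomial, map_smul, h1, smul_eq_mul, smul_eq_mul,
      mul_one]
  refine ⟨E, ?_, ?_, ?_, ?_⟩
  · have := hE 0 1
    rwa [map_zero, he0, mul_one] at this
  · intro p hp
    have hexp : E (p ^ 2) = ∑ a ∈ p.support, ∑ b ∈ p.support,
        p.coeff a * p.coeff b * e (parity a + parity b) := by
      conv_lhs => rw [p.as_sum, sq, Finset.sum_mul_sum]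
      simp only [map_sum, monomial_mul, hE, map_add]
    have hdeg : ∀ a ∈ p.support, hammingNorm (parity a) ≤ D / 2 := fun a ha =>
      (hammingNorm_parity_le a).trans ((le_totalDegree ha).trans hp)
    rw [hexp]
    refine sum_mul_kernel_nonneg _ (fun a b => e (parity a + parity b)) ?_ ?_ ?_ _
    · intro a _
      simp only [two', he0]
    · intro a _ b _
      simp only [add_comm]
    · intro a ha b hb c hc h1 h2
      have h3 : parity a + parity c = (parity a + parity b) + (parity b + parity c) := by
        rw [add_assoc, ← add_assoc (parity b), two', zero_add]
      have h4 : hammingNorm (parity a + parity c) ≤ D :=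
        (hammingNorm_add_le' _ _).trans (by have := hdeg a ha; have := hdeg c hc; omega)
      rw [h3] at h4 ⊢
      exact hemul _ _ h4 h1 h2
  · intro i q
    induction q using MvPolynomial.induction_on' with
    | add p q hp hq => rw [mul_add, map_add, hp, hq, add_zero]
    | monomial α c =>
      have : (X i ^ 2 - 1 : MvPolynomial (Fin n) ℝ) * monomial α c
          = monomial (Finsupp.single i 1 + (Finsupp.single i 1 + α)) c - monomial α c := by
        rw [sub_mul, one_mul, sq, X, mul_assoc, monomial_mul, monomial_mul, one_mul, one_mul]
      rw [this, map_sub, hE, hE, map_add, map_add, ← add_assoc, two', zero_add, sub_self]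
  · intro α T hT hα
    rw [hE, one_mul, ← hα, he T hT]

section Swap

variable {n s : ℕ} {J : Type*}

/-- The product of the entries `z i` over all positions of a pair of tuples. -/
def tupleProd {G : Type*} [CommMonoid G] (z : Fin n → G)
    (I : (Fin s → Fin n) × (Fin s → Fin n)) : G :=
  (∏ r, z (I.1 r)) * ∏ r, z (I.2 r)

/-- The value of the clause `j`, a product of four variables given as two pairs. -/
def clauseProd {G : Type*} [CommMonoid G] (z : Fin n → G) (F : J × Bool → Fin n × Fin n)
    (j : J) : G :=
  (z (F (j, true)).1 * z (F (j, true)).2) * (z (F (j, false)).1 * z (F (j, false)).2)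

/-- A pair of positions carrying one half of a clause. -/
def IsHit (F : J × Bool → Fin n × Fin n) (I : (Fin s → Fin n) × (Fin s → Fin n))
    (h : (Fin s × Fin s) × (J × Bool)) : Prop :=
  F h.2 = (I.1 h.1.1, I.2 h.1.2)

/-- The same positions, with the other half of the clause. -/
def hitRev (h : (Fin s × Fin s) × (J × Bool)) : (Fin s × Fin s) × (J × Bool) :=
  (h.1, (h.2.1, !h.2.2))

/-- Replace one half of a clause by the other half at the given positions. -/
def hitFlip (F : J × Bool → Fin n × Fin n) (I : (Fin s → Fin n) × (Fin s → Fin n))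
    (h : (Fin s × Fin s) × (J × Bool)) : (Fin s → Fin n) × (Fin s → Fin n) :=
  (Function.update I.1 h.1.1 (F (hitRev h).2).1, Function.update I.2 h.1.2 (F (hitRev h).2).2)

/-- `h` is the only hit of `I`. -/
def IsUniqueHit (F : J × Bool → Fin n × Fin n) (I : (Fin s → Fin n) × (Fin s → Fin n))
    (h : (Fin s × Fin s) × (J × Bool)) : Prop :=
  IsHit F I h ∧ ∀ h', IsHit F I h' → h' = h

/-- `h` is the only hit of `I`, and remains the only one after flipping it. -/
def IsGoodHit (F : J × Bool → Fin n × Fin n) (I : (Fin s → Fin n) × (Fin s → Fin n))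
    (h : (Fin s × Fin s) × (J × Bool)) : Prop :=
  IsUniqueHit F I h ∧ IsUniqueHit F (hitFlip F I h) (hitRev h)

variable {F : J × Bool → Fin n × Fin n} {I : (Fin s → Fin n) × (Fin s → Fin n)}
  {h h' : (Fin s × Fin s) × (J × Bool)}

lemma hitRev_hitRev (h : (Fin s × Fin s) × (J × Bool)) : hitRev (hitRev h) = h := by
  simp [hitRev]

lemma hitRev_ne (h : (Fin s × Fin s) × (J × Bool)) : hitRev h ≠ h := by
  intro e
  have := congrArg (fun h => h.2.2) e
  simp [hitRev] at this

lemma IsHit.flip (_ : IsHit F I h) : IsHit F (hitFlip F I h) (hitRev h) := by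
  simp [IsHit, hitRev, hitFlip]

lemma IsHit.flip_flip (hh : IsHit F I h) : hitFlip F (hitFlip F I h) (hitRev h) = I := by
  have h1 := congrArg Prod.fst hh
  have h2 := congrArg Prod.snd hh
  simp only at h1 h2
  simp [hitFlip, h1, h2, hitRev]

lemma mul_prod_update {G ι : Type*} [CommMonoid G] [Fintype ι] [DecidableEq ι] (z : Fin n → G)
    (hz : ∀ i, z i * z i = 1) (f : ι → Fin n) (r : ι) (c : Fin n) :
    (∏ k, z (f k)) * ∏ k, z (Function.update f r c k) = z (f r) * z c := by
  have h1 : ∀ k, z (Function.update f r c k) = Function.update (fun k => z (f k)) r (z c) k := by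
    intro k
    by_cases hk : k = r
    · subst hk; simp
    · simp [hk]
  simp_rw [h1]
  rw [Finset.prod_update_of_mem (Finset.mem_univ r),
    ← Finset.mul_prod_erase _ _ (Finset.mem_univ r), Finset.sdiff_singleton_eq_erase,
    mul_mul_mul_comm, ← Finset.prod_mul_distrib]
  simp [hz]

lemma IsHit.tupleProd_mul {G : Type*} [CommMonoid G] (z : Fin n → G) (hz : ∀ i, z i * z i = 1)
    (hh : IsHit F I h) :
    tupleProd z I * tupleProd z (hitFlip F I h) = clauseProd z F h.2.1 := by
  have h1 := congrArg Prod.fst hh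
  have h2 := congrArg Prod.snd hh
  simp only at h1 h2
  rw [tupleProd, tupleProd, mul_mul_mul_comm]
  simp only [hitFlip]
  rw [mul_prod_update z hz, mul_prod_update z hz, ← h1, ← h2, mul_mul_mul_comm, clauseProd]
  obtain ⟨rt, j, b⟩ := h
  cases b
  · exact mul_comm _ _
  · rfl

lemma IsGoodHit.eq (hh : IsGoodHit F I h) (hh' : IsGoodHit F I h') : h = h' :=
  hh'.1.2 _ hh.1.1

lemma IsGoodHit.flip (hh : IsGoodHit F I h) :
    IsGoodHit F (hitFlip F I h) (hitRev h) := by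
  refine ⟨hh.2, ?_⟩
  rw [hh.1.1.flip_flip, hitRev_hitRev]
  exact hh.1

open Classical in
/-- Flip the good hit, if there is one. -/
noncomputable def swapTuple (F : J × Bool → Fin n × Fin n)
    (I : (Fin s → Fin n) × (Fin s → Fin n)) : (Fin s → Fin n) × (Fin s → Fin n) :=
  if hI : ∃ h, IsGoodHit F I h then hitFlip F I hI.choose else I

open Classical in
/-- The indicator of the clause used by `swapTuple`. -/
noncomputable def swapClause (F : J × Bool → Fin n × Fin n)
    (I : (Fin s → Fin n) × (Fin s → Fin n)) : J → ZMod 2 :=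
  if hI : ∃ h, IsGoodHit F I h then Pi.single hI.choose.2.1 1 else 0

lemma IsGoodHit.swapTuple_eq (hh : IsGoodHit F I h) :
    swapTuple F I = hitFlip F I h := by
  have hI : ∃ h, IsGoodHit F I h := ⟨h, hh⟩
  rw [swapTuple, dif_pos hI, hI.choose_spec.eq hh]

open Classical in
lemma IsGoodHit.swapClause_eq (hh : IsGoodHit F I h) :
    swapClause F I = Pi.single h.2.1 1 := by
  have hI : ∃ h, IsGoodHit F I h := ⟨h, hh⟩
  rw [swapClause, dif_pos hI, hI.choose_spec.eq hh]

lemma swapTuple_of_not (hI : ¬ ∃ h, IsGoodHit F I h) : swapTuple F I = I := dif_neg hI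

lemma swapClause_of_not (hI : ¬ ∃ h, IsGoodHit F I h) : swapClause F I = 0 := dif_neg hI

lemma swapTuple_swapTuple (F : J × Bool → Fin n × Fin n)
    (I : (Fin s → Fin n) × (Fin s → Fin n)) : swapTuple F (swapTuple F I) = I := by
  by_cases hI : ∃ h, IsGoodHit F I h
  · obtain ⟨h, hh⟩ := hI
    rw [hh.swapTuple_eq, hh.flip.swapTuple_eq, hh.1.1.flip_flip]
  · rw [swapTuple_of_not hI, swapTuple_of_not hI]

lemma swapClause_swapTuple (F : J × Bool → Fin n × Fin n)
    (I : (Fin s → Fin n) × (Fin s → Fin n)) :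
    swapClause F (swapTuple F I) = swapClause F I := by
  by_cases hI : ∃ h, IsGoodHit F I h
  · obtain ⟨h, hh⟩ := hI
    rw [hh.swapTuple_eq, hh.flip.swapClause_eq, hh.swapClause_eq]
    rfl
  · rw [swapTuple_of_not hI]

lemma swapClause_eq_zero (hI : swapTuple F I = I) : swapClause F I = 0 := by
  refine swapClause_of_not fun ⟨h, hh⟩ => ?_
  have h1 := hh.1.1.flip
  rw [← hh.swapTuple_eq, hI] at h1
  exact hitRev_ne h (hh.1.2 _ h1)

lemma hammingNorm_swapClause_le [Fintype J] (F : J × Bool → Fin n × Fin n)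
    (I : (Fin s → Fin n) × (Fin s → Fin n)) : hammingNorm (swapClause F I) ≤ 1 := by
  classical
  by_cases hI : ∃ h, IsGoodHit F I h
  · obtain ⟨h, hh⟩ := hI
    rw [hh.swapClause_eq]
    refine (Finset.card_le_card (t := {h.2.1}) fun j hj => ?_).trans (by simp)
    simpa [Pi.single_apply] using hj
  · simp [swapClause_of_not hI]

/-- The sum of the unit vectors at all positions of a pair of tuples. -/
def tupleParity (I : (Fin s → Fin n) × (Fin s → Fin n)) : Fin n → ZMod 2 :=
  ∑ r, Pi.single (I.1 r) 1 + ∑ r, Pi.single (I.2 r) 1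

/-- The sum of the unit vectors at the four variables of a clause. -/
def clauseParity (F : J × Bool → Fin n × Fin n) (j : J) : Fin n → ZMod 2 :=
  (Pi.single (F (j, true)).1 1 + Pi.single (F (j, true)).2 1) +
    (Pi.single (F (j, false)).1 1 + Pi.single (F (j, false)).2 1)

lemma tupleParity_add_swapTuple [Fintype J] (F : J × Bool → Fin n × Fin n)
    (I : (Fin s → Fin n) × (Fin s → Fin n)) :
    tupleParity I + tupleParity (swapTuple F I)
      = Fintype.linearCombination (ZMod 2) (clauseParity F) (swapClause F I) := by
  classical
  by_cases hI : ∃ h, IsGoodHit F I h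
  · obtain ⟨h, hh⟩ := hI
    rw [hh.swapTuple_eq, hh.swapClause_eq, Fintype.linearCombination_apply_single, one_smul]
    let z : Fin n → Multiplicative (Fin n → ZMod 2) := fun i => Multiplicative.ofAdd (Pi.single i 1)
    have two : ∀ v : Fin n → ZMod 2, v + v = 0 :=
      fun v => funext fun _ => CharTwo.add_self_eq_zero _
    exact hh.1.1.tupleProd_mul z fun i => congrArg Multiplicative.ofAdd (two (Pi.single i 1))
  · rw [swapTuple_of_not hI, swapClause_of_not hI, map_zero]
    exact funext fun k => CharTwo.add_self_eq_zero (tupleParity I k)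

end Swap

section Counting

lemma card_filter_forall_mem_mul {ι κ : Type*} [Fintype ι] [DecidableEq ι] [Fintype κ]
    [DecidableEq κ] (A : Finset ι) (S : ι → Finset κ) :
    (Finset.univ.filter fun f : ι → κ => ∀ i ∈ A, f i ∈ S i).card * Fintype.card κ ^ A.card
      = (∏ i ∈ A, (S i).card) * Fintype.card κ ^ Fintype.card ι := by
  have h1 : (Finset.univ.filter fun f : ι → κ => ∀ i ∈ A, f i ∈ S i)
      = Fintype.piFinset fun i => if i ∈ A then S i else Finset.univ := by
    ext f
    simp only [Finset.mem_filter, Finset.mem_univ, true_and, Fintype.mem_piFinset]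
    refine forall_congr' fun i => ?_
    split_ifs with h <;> simp [h]
  have h2 : ∀ i, (if i ∈ A then S i else Finset.univ).card
      = if i ∈ A then (S i).card else Fintype.card κ := fun i => by split_ifs <;> simp
  rw [h1, Fintype.card_piFinset]
  simp_rw [h2]
  rw [Finset.prod_ite, Finset.prod_const, Finset.filter_mem_eq_inter, Finset.univ_inter, mul_assoc,
    ← pow_add]
  congr 2
  have h3 : (Finset.univ.filter fun i => i ∉ A) = Aᶜ := by ext; simp
  rw [h3, Finset.card_compl, Nat.sub_add_cancel (Finset.card_le_univ A)]

variable {ι κ : Type*} [Fintype ι] [DecidableEq ι] [Fintype κ] [DecidableEq κ]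

lemma card_filter_apply_eq_mul (a : ι) (x : κ) :
    (Finset.univ.filter fun f : ι → κ => f a = x).card * Fintype.card κ
      = Fintype.card κ ^ Fintype.card ι := by
  simpa using card_filter_forall_mem_mul {a} fun _ : ι => ({x} : Finset κ)

lemma card_filter_apply_eq_and_mul {a b : ι} (hab : a ≠ b) (x y : κ) :
    (Finset.univ.filter fun f : ι → κ => f a = x ∧ f b = y).card * Fintype.card κ ^ 2
      = Fintype.card κ ^ Fintype.card ι := by
  have := card_filter_forall_mem_mul {a, b} fun i : ι => if i = a then ({x} : Finset κ) else {y}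
  simpa [Finset.card_pair hab, hab.symm, Finset.prod_pair hab] using this

lemma card_filter_apply_eq_apply_mul {a b : ι} (hab : a ≠ b) :
    (Finset.univ.filter fun f : ι → κ => f a = f b).card * Fintype.card κ
      = Fintype.card κ ^ Fintype.card ι := by
  rcases isEmpty_or_nonempty κ with hκ | hκ
  · have : Fintype.card ι ≠ 0 := (Fintype.card_pos_iff.2 ⟨a⟩).ne'
    simp [this]
  have h1 : (Finset.univ.filter fun f : ι → κ => f a = f b).card
      = ∑ x : κ, (Finset.univ.filter fun f : ι → κ => f a = x ∧ f b = x).card := by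
    rw [Finset.card_eq_sum_card_fiberwise (f := fun f : ι → κ => f a) (t := Finset.univ)
      (fun _ _ => Finset.mem_coe.2 (Finset.mem_univ _))]
    refine Finset.sum_congr rfl fun x _ => congrArg _ ?_
    ext f
    simp only [Finset.mem_filter, Finset.mem_univ, true_and]
    exact ⟨fun ⟨h, h'⟩ => ⟨h', h ▸ h'⟩, fun ⟨h, h'⟩ => ⟨h.trans h'.symm, h⟩⟩
  have hpos : 0 < Fintype.card κ := Fintype.card_pos
  refine Nat.eq_of_mul_eq_mul_right hpos ?_
  rw [h1, mul_assoc, ← sq, Finset.sum_mul]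
  simp_rw [card_filter_apply_eq_and_mul hab]
  rw [Finset.sum_const, Finset.card_univ, smul_eq_mul, mul_comm]

end Counting

section Violation

variable {n s : ℕ} {J : Type*} [Fintype J]

open Classical in
/-- The number of ordered pairs of distinct hits, over all pairs of tuples. -/
noncomputable def hitCollisions (s : ℕ) (F : J × Bool → Fin n × Fin n) : ℕ :=
  (Finset.univ.filter fun w : ((Fin s → Fin n) × (Fin s → Fin n)) ×
      ((Fin s × Fin s) × (J × Bool)) × ((Fin s × Fin s) × (J × Bool)) =>
    w.2.1 ≠ w.2.2 ∧ IsHit F w.1 w.2.1 ∧ IsHit F w.1 w.2.2).card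

omit [Fintype J] in
open Classical in
lemma card_isHit_mul (F : J × Bool → Fin n × Fin n) (h : (Fin s × Fin s) × (J × Bool)) :
    (Finset.univ.filter fun I : (Fin s → Fin n) × (Fin s → Fin n) => IsHit F I h).card * n ^ 2
      = n ^ s * n ^ s := by
  have h1 : (Finset.univ.filter fun I : (Fin s → Fin n) × (Fin s → Fin n) => IsHit F I h)
      = (Finset.univ.filter fun f : Fin s → Fin n => f h.1.1 = (F h.2).1) ×ˢ
        (Finset.univ.filter fun f : Fin s → Fin n => f h.1.2 = (F h.2).2) := by
    ext I
    simp only [Finset.mem_filter, Finset.mem_univ, true_and, Finset.mem_product, IsHit,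
      Prod.ext_iff, eq_comm]
  have h2 := card_filter_apply_eq_mul h.1.1 (F h.2).1
  have h3 := card_filter_apply_eq_mul h.1.2 (F h.2).2
  rw [Fintype.card_fin, Fintype.card_fin] at h2 h3
  rw [h1, Finset.card_product, sq, mul_mul_mul_comm]
  convert congrArg₂ (· * ·) h2 h3

open Classical in
lemma card_violated_le (F : J × Bool → Fin n × Fin n) (V : J → Prop) :
    s ^ 2 * (2 * (Finset.univ.filter V).card) * (n ^ s * n ^ s) ≤
      n ^ 2 * ((Finset.univ.filter fun I : (Fin s → Fin n) × (Fin s → Fin n) =>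
        ∃ h, IsGoodHit F I h ∧ V h.2.1).card + 2 * hitCollisions s F) := by
  let Y := Finset.univ.filter fun w : ((Fin s → Fin n) × (Fin s → Fin n)) ×
      ((Fin s × Fin s) × (J × Bool)) => IsHit F w.1 w.2 ∧ V w.2.2.1
  let N := Finset.univ.filter fun w : ((Fin s → Fin n) × (Fin s → Fin n)) ×
      ((Fin s × Fin s) × (J × Bool)) => IsHit F w.1 w.2 ∧ ¬ IsUniqueHit F w.1 w.2
  let G := Finset.univ.filter fun w : ((Fin s → Fin n) × (Fin s → Fin n)) ×
      ((Fin s × Fin s) × (J × Bool)) => IsGoodHit F w.1 w.2 ∧ V w.2.2.1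
  let fl : ((Fin s → Fin n) × (Fin s → Fin n)) × ((Fin s × Fin s) × (J × Bool)) →
      ((Fin s → Fin n) × (Fin s → Fin n)) × ((Fin s × Fin s) × (J × Bool)) :=
    fun w => (hitFlip F w.1 w.2, hitRev w.2)
  have hsub : Y ⊆ G ∪ (N ∪ N.image fl) := by
    rintro ⟨I, h⟩ hw
    simp only [Y, Finset.mem_filter, Finset.mem_univ, true_and] at hw
    simp only [G, N, Finset.mem_union, Finset.mem_filter, Finset.mem_univ, true_and,
      Finset.mem_image]
    by_cases h1 : IsUniqueHit F I h
    · by_cases h2 : IsUniqueHit F (hitFlip F I h) (hitRev h)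
      · exact Or.inl ⟨⟨h1, h2⟩, hw.2⟩
      · refine Or.inr (Or.inr ⟨(hitFlip F I h, hitRev h), ⟨hw.1.flip, h2⟩, ?_⟩)
        simp only [fl, hw.1.flip_flip, hitRev_hitRev]
    · exact Or.inr (Or.inl ⟨hw.1, h1⟩)
  have hN : N.card ≤ hitCollisions s F := by
    refine Finset.card_le_card_of_surjOn (fun w => (w.1, w.2.1)) ?_
    rintro ⟨I, h⟩ hw
    simp only [N, Finset.coe_filter, Finset.mem_univ, true_and, Set.mem_ofPred_eq, IsUniqueHit,
      not_and, not_forall] at hw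
    obtain ⟨h', hh', hne⟩ := hw.2 hw.1
    refine ⟨(I, h, h'), ?_, rfl⟩
    simp only [Finset.coe_filter, Finset.mem_univ, true_and, Set.mem_ofPred_eq]
    exact ⟨Ne.symm hne, hw.1, hh'⟩
  have hG : G.card ≤ (Finset.univ.filter fun I : (Fin s → Fin n) × (Fin s → Fin n) =>
        ∃ h, IsGoodHit F I h ∧ V h.2.1).card := by
    refine Finset.card_le_card_of_injOn Prod.fst ?_ ?_
    · rintro ⟨I, h⟩ hw
      simp only [G, Finset.coe_filter, Finset.mem_univ, true_and, Set.mem_ofPred_eq] at hw ⊢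
      exact ⟨h, hw⟩
    · rintro ⟨I, h⟩ hw ⟨I', h'⟩ hw' rfl
      simp only [G, Finset.coe_filter, Finset.mem_univ, true_and, Set.mem_ofPred_eq] at hw hw'
      rw [hw.1.eq hw'.1]
  have hY : Y.card * n ^ 2 = s ^ 2 * (2 * (Finset.univ.filter V).card) * (n ^ s * n ^ s) := by
    have h1 : Y.card = ∑ h ∈ Finset.univ.filter (fun h : (Fin s × Fin s) × (J × Bool) => V h.2.1),
        (Finset.univ.filter fun I : (Fin s → Fin n) × (Fin s → Fin n) => IsHit F I h).card := by
      rw [Finset.card_eq_sum_card_fiberwise (f := Prod.snd)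
        (t := Finset.univ.filter (fun h : (Fin s × Fin s) × (J × Bool) => V h.2.1))]
      · refine Finset.sum_congr rfl fun h hh => ?_
        refine Finset.card_bij' (fun w _ => w.1) (fun I _ => (I, h)) ?_ ?_ ?_ ?_
        · rintro ⟨I, h⟩ hw
          simp only [Y, Finset.mem_filter, Finset.mem_univ, true_and] at hw ⊢
          exact hw.2 ▸ hw.1.1
        · intro I hI
          simp only [Y, Finset.mem_filter, Finset.mem_univ, true_and] at hI hh ⊢
          exact ⟨⟨hI, hh⟩, trivial⟩
        · rintro ⟨I, h⟩ hw
          simp only [Y, Finset.mem_filter, Finset.mem_univ, true_and] at hw ⊢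
          rw [hw.2]
        · simp
      · rintro ⟨I, h⟩ hw
        simp only [Y, Finset.coe_filter, Finset.mem_univ, true_and, Set.mem_ofPred_eq] at hw ⊢
        exact hw.2
    have h2 : (Finset.univ.filter (fun h : (Fin s × Fin s) × (J × Bool) => V h.2.1)).card
        = s ^ 2 * (2 * (Finset.univ.filter V).card) := by
      have : (Finset.univ.filter (fun h : (Fin s × Fin s) × (J × Bool) => V h.2.1))
          = (Finset.univ : Finset (Fin s × Fin s)) ×ˢ
            ((Finset.univ.filter V) ×ˢ (Finset.univ : Finset Bool)) := by
        ext h; simp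
      rw [this, Finset.card_product, Finset.card_product]
      simp only [Finset.card_univ, Fintype.card_prod, Fintype.card_fin, Fintype.card_bool]
      ring
    rw [h1, Finset.sum_mul]
    simp_rw [card_isHit_mul]
    rw [Finset.sum_const, h2, smul_eq_mul]
  have hle : Y.card ≤ G.card + (N.card + N.card) :=
    (Finset.card_le_card hsub).trans <| (Finset.card_union_le _ _).trans <|
      Nat.add_le_add_left ((Finset.card_union_le _ _).trans
        (Nat.add_le_add_left Finset.card_image_le _)) _
  rw [← hY, mul_comm]
  exact Nat.mul_le_mul_left _ (by omega)

end Violation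

section Average

variable {n s : ℕ} {J : Type*} [Fintype J] [DecidableEq J]

open Classical in
lemma card_pair_isHit_le (h h' : (Fin s × Fin s) × (J × Bool)) (hne : h ≠ h') :
    (Finset.univ.filter fun w : (J × Bool → Fin n × Fin n) ×
        ((Fin s → Fin n) × (Fin s → Fin n)) =>
      IsHit w.1 w.2 h ∧ IsHit w.1 w.2 h').card * n ^ 4
      ≤ (if h.2 = h'.2 then n else 1) *
        ((n ^ s * n ^ s) * Fintype.card (J × Bool → Fin n × Fin n)) := by
  have hcardF : Fintype.card (J × Bool → Fin n × Fin n)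
      = Fintype.card (Fin n × Fin n) ^ Fintype.card (J × Bool) := Fintype.card_fun
  have hκ : Fintype.card (Fin n × Fin n) = n ^ 2 := by simp [sq]
  have hfib : (Finset.univ.filter fun w : (J × Bool → Fin n × Fin n) ×
        ((Fin s → Fin n) × (Fin s → Fin n)) => IsHit w.1 w.2 h ∧ IsHit w.1 w.2 h').card
      = ∑ I : (Fin s → Fin n) × (Fin s → Fin n),
        (Finset.univ.filter fun F : J × Bool → Fin n × Fin n =>
          IsHit F I h ∧ IsHit F I h').card := by
    rw [Finset.card_eq_sum_card_fiberwise (f := Prod.snd) (t := Finset.univ)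
      (fun _ _ => Finset.mem_coe.2 (Finset.mem_univ _))]
    refine Finset.sum_congr rfl fun I _ => ?_
    refine Finset.card_bij' (fun w _ => w.1) (fun F _ => (F, I)) ?_ ?_ ?_ ?_
    · rintro ⟨F, I'⟩ hw
      simp only [Finset.mem_filter, Finset.mem_univ, true_and] at hw ⊢
      exact hw.2 ▸ hw.1
    · intro F hF
      simpa using hF
    · rintro ⟨F, I'⟩ hw
      simp only [Finset.mem_filter, Finset.mem_univ, true_and] at hw ⊢
      rw [hw.2]
    · simp
  rw [hfib, Finset.sum_mul]
  by_cases hq : h.2 = h'.2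
  · rw [if_pos hq]
    have hrt : h.1.1 ≠ h'.1.1 ∨ h.1.2 ≠ h'.1.2 := by
      by_contra! hc
      exact hne (Prod.ext (Prod.ext hc.1 hc.2) hq)
    let P : (Fin s → Fin n) × (Fin s → Fin n) → Prop := fun I =>
      I.1 h.1.1 = I.1 h'.1.1 ∧ I.2 h.1.2 = I.2 h'.1.2
    have hterm : ∀ I : (Fin s → Fin n) × (Fin s → Fin n),
        (Finset.univ.filter fun F : J × Bool → Fin n × Fin n =>
          IsHit F I h ∧ IsHit F I h').card * n ^ 4
        ≤ if P I then n ^ 2 * Fintype.card (J × Bool → Fin n × Fin n) else 0 := by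
      intro I
      split_ifs with hP
      · have h1 := card_filter_apply_eq_mul (ι := J × Bool) (κ := Fin n × Fin n) h.2
          (I.1 h.1.1, I.2 h.1.2)
        rw [← hcardF, hκ] at h1
        rw [← h1]
        have h2 : (Finset.univ.filter fun F : J × Bool → Fin n × Fin n =>
            IsHit F I h ∧ IsHit F I h').card
          ≤ (Finset.univ.filter fun F : J × Bool → Fin n × Fin n =>
              F h.2 = (I.1 h.1.1, I.2 h.1.2)).card :=
          Finset.card_le_card fun F hF => by
            simp only [Finset.mem_filter, Finset.mem_univ, true_and] at hF ⊢
            exact hF.1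
        calc _ ≤ _ := Nat.mul_le_mul_right _ h2
          _ = _ := by ring_nf
      · rw [Nat.le_zero, Nat.mul_eq_zero]
        left
        rw [Finset.card_eq_zero, Finset.filter_eq_empty_iff]
        rintro F - ⟨h1, h2⟩
        unfold IsHit at h1 h2
        rw [← hq, h1, Prod.mk.injEq] at h2
        exact hP h2
    have hP : (Finset.univ.filter P).card * n ≤ n ^ s * n ^ s := by
      have hle : ∀ A : Finset (Fin s → Fin n), A.card ≤ n ^ s := fun A =>
        (Finset.card_le_univ A).trans_eq (by simp)
      have hsub : Finset.univ.filter P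
          ⊆ (Finset.univ.filter fun f : Fin s → Fin n => f h.1.1 = f h'.1.1) ×ˢ
            (Finset.univ.filter fun f : Fin s → Fin n => f h.1.2 = f h'.1.2) := by
        intro I hI
        simpa [P] using hI
      refine (Nat.mul_le_mul_right _ (Finset.card_le_card hsub)).trans ?_
      rw [Finset.card_product]
      rcases hrt with hr | ht
      · have := card_filter_apply_eq_apply_mul (κ := Fin n) hr
        rw [Fintype.card_fin, Fintype.card_fin] at this
        rw [mul_right_comm]
        refine Nat.mul_le_mul (le_of_eq ?_) (hle _)
        convert this
      · have := card_filter_apply_eq_apply_mul (κ := Fin n) ht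
        rw [Fintype.card_fin, Fintype.card_fin] at this
        rw [mul_assoc]
        refine Nat.mul_le_mul (hle _) (le_of_eq ?_)
        convert this
    refine (Finset.sum_le_sum fun I _ => hterm I).trans ?_
    rw [← Finset.sum_filter, Finset.sum_const, smul_eq_mul]
    calc (Finset.univ.filter P).card * (n ^ 2 * Fintype.card (J × Bool → Fin n × Fin n))
        = n * ((Finset.univ.filter P).card * n * Fintype.card (J × Bool → Fin n × Fin n)) := by
          ring
      _ ≤ _ := Nat.mul_le_mul_left _ (Nat.mul_le_mul_right _ hP)
  · rw [if_neg hq, one_mul]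
    have hterm : ∀ I : (Fin s → Fin n) × (Fin s → Fin n),
        (Finset.univ.filter fun F : J × Bool → Fin n × Fin n =>
          IsHit F I h ∧ IsHit F I h').card * n ^ 4
        = Fintype.card (J × Bool → Fin n × Fin n) := by
      intro I
      have h1 := card_filter_apply_eq_and_mul (κ := Fin n × Fin n) hq
        (I.1 h.1.1, I.2 h.1.2) (I.1 h'.1.1, I.2 h'.1.2)
      rw [← hcardF, hκ, ← pow_mul] at h1
      unfold IsHit
      convert h1
    rw [Finset.sum_congr rfl fun I _ => hterm I, Finset.sum_const]
    simp

lemma sum_hitCollisions_mul_le :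
    (∑ F : J × Bool → Fin n × Fin n, hitCollisions s F) * n ^ 4
      ≤ (s ^ 4 * (2 * Fintype.card J) ^ 2 + s ^ 4 * (2 * Fintype.card J) * n) *
        ((n ^ s * n ^ s) * Fintype.card (J × Bool → Fin n × Fin n)) := by
  classical
  let H := (Fin s × Fin s) × (J × Bool)
  have hsum : ∑ F : J × Bool → Fin n × Fin n, hitCollisions s F
      = ∑ p : H × H, if p.1 ≠ p.2 then
          (Finset.univ.filter fun w : (J × Bool → Fin n × Fin n) ×
            ((Fin s → Fin n) × (Fin s → Fin n)) =>
            IsHit w.1 w.2 p.1 ∧ IsHit w.1 w.2 p.2).card else 0 := by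
    have h1 : ∀ F : J × Bool → Fin n × Fin n, hitCollisions s F
        = ∑ p : H × H, ∑ I : (Fin s → Fin n) × (Fin s → Fin n),
          if p.1 ≠ p.2 ∧ IsHit F I p.1 ∧ IsHit F I p.2 then 1 else 0 := fun F => by
      rw [hitCollisions, Finset.card_filter, Fintype.sum_prod_type, Finset.sum_comm]
      exact Finset.sum_congr rfl fun p _ => Finset.sum_congr rfl fun I _ => by congr
    simp_rw [h1]
    rw [Finset.sum_comm]
    refine Finset.sum_congr rfl fun p _ => ?_
    by_cases hp : p.1 ≠ p.2
    · rw [if_pos hp, Finset.card_filter, Fintype.sum_prod_type]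
      simp [hp]
    · simp [hp]
  rw [hsum, Finset.sum_mul]
  have hterm : ∀ p : H × H, (if p.1 ≠ p.2 then
          (Finset.univ.filter fun w : (J × Bool → Fin n × Fin n) ×
            ((Fin s → Fin n) × (Fin s → Fin n)) =>
            IsHit w.1 w.2 p.1 ∧ IsHit w.1 w.2 p.2).card else 0) * n ^ 4
      ≤ (1 + if p.1.2 = p.2.2 then n else 0) *
        ((n ^ s * n ^ s) * Fintype.card (J × Bool → Fin n × Fin n)) := by
    intro p
    by_cases hp : p.1 ≠ p.2
    · rw [if_pos hp]
      refine (card_pair_isHit_le p.1 p.2 hp).trans (Nat.mul_le_mul_right _ ?_)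
      split_ifs <;> omega
    · rw [if_neg hp, zero_mul]
      exact Nat.zero_le _
  refine (Finset.sum_le_sum fun p _ => hterm p).trans ?_
  rw [← Finset.sum_mul, Finset.sum_add_distrib]
  refine Nat.mul_le_mul_right _ (le_of_eq ?_)
  congr 1
  · simp [H]
    ring
  · simp [H, Fintype.sum_prod_type]
    ring

end Average

section Expansion

lemma inv_factorial_le (t : ℕ) : ((t.factorial : ℝ))⁻¹ ≤ Real.exp 1 ^ t / (t : ℝ) ^ t := by
  rcases Nat.eq_zero_or_pos t with rfl | ht
  · simp
  have h := Real.pow_div_factorial_le_exp (t : ℝ) (Nat.cast_nonneg t) t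
  have htp : (0 : ℝ) < (t : ℝ) ^ t := by positivity
  rw [le_div_iff₀ htp, ← Real.exp_nat_mul, mul_one]
  calc _ = (t : ℝ) ^ t / t.factorial := by ring
    _ ≤ _ := h

lemma choose_mul_choose_mul_le {n t : ℕ} (ht : 1 ≤ t) (htn : (t : ℝ) ≤ 4 / 10 ^ 10 * n) :
    ((8 * n).choose t : ℝ) * (n.choose (5 * t / 2) * ((5 * t / 2 : ℕ) / n : ℝ) ^ (4 * t))
      ≤ (1 / 8 : ℝ) ^ t := by
  obtain ⟨v, hv⟩ : ∃ v, v = 5 * t / 2 := ⟨_, rfl⟩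
  rw [← hv]
  have ht0 : (0 : ℝ) < t := by exact_mod_cast ht
  have hn0 : (0 : ℝ) < n := by linarith
  have hv1 : 1 ≤ v := by omega
  have hv0 : (0 : ℝ) < v := by exact_mod_cast hv1
  have hv3 : v ≤ 3 * t := by omega
  have hv3' : (v : ℝ) ≤ 3 * t := by exact_mod_cast hv3
  set y := Real.sqrt (3 * t / n) with hy
  have hy2 : y ^ 2 = 3 * t / n := Real.sq_sqrt (by positivity)
  have hy0 : 0 < y := Real.sqrt_pos.2 (by positivity)
  have hysmall : y ≤ 35 / 10 ^ 6 := by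
    refine Real.sqrt_le_iff.2 ⟨by norm_num, ?_⟩
    rw [div_le_iff₀ hn0]
    linarith
  have hexp1 : (1 : ℝ) ≤ Real.exp 1 := Real.one_le_exp (by norm_num)
  have h1 : ((8 * n).choose t : ℝ) ≤ (24 * Real.exp 1 / y ^ 2) ^ t := by
    calc ((8 * n).choose t : ℝ) ≤ ((8 * n : ℕ) : ℝ) ^ t / t.factorial :=
          Nat.choose_le_pow_div t (8 * n)
      _ = ((8 * n : ℕ) : ℝ) ^ t * (t.factorial : ℝ)⁻¹ := div_eq_mul_inv _ _
      _ ≤ ((8 * n : ℕ) : ℝ) ^ t * (Real.exp 1 ^ t / (t : ℝ) ^ t) := by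
          gcongr
          exact inv_factorial_le t
      _ = (24 * Real.exp 1 / y ^ 2) ^ t := by
          rw [hy2, ← div_pow, ← mul_pow]
          congr 1
          push_cast
          field_simp
          norm_num
  have h2 : (n.choose v : ℝ) * ((v : ℝ) / n) ^ (4 * t) ≤ (Real.exp 1 ^ 3 * y ^ 3) ^ t := by
    have h4 : 4 * t = v + (4 * t - v) := by omega
    calc (n.choose v : ℝ) * ((v : ℝ) / n) ^ (4 * t)
        ≤ ((n : ℝ) ^ v * (Real.exp 1 ^ v / (v : ℝ) ^ v)) * ((v : ℝ) / n) ^ (4 * t) := by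
          gcongr
          refine (Nat.choose_le_pow_div v n).trans ?_
          rw [div_eq_mul_inv]
          gcongr
          exact inv_factorial_le v
      _ = Real.exp 1 ^ v * ((v : ℝ) / n) ^ (4 * t - v) := by
          conv_lhs => rw [h4, pow_add]
          rw [div_pow (v : ℝ) (n : ℝ) v]
          field_simp
      _ ≤ Real.exp 1 ^ (3 * t) * (y ^ 2) ^ (4 * t - v) := by
          gcongr
          rw [hy2]
          gcongr
      _ ≤ Real.exp 1 ^ (3 * t) * y ^ (3 * t) := by
          rw [← pow_mul]
          refine mul_le_mul_of_nonneg_left ?_ (by positivity)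
          exact pow_le_pow_of_le_one hy0.le (by linarith) (by omega)
      _ = _ := by rw [mul_pow, ← pow_mul, ← pow_mul]
  have he : Real.exp 1 ^ 4 ≤ 55 := by
    have h := Real.exp_one_lt_d9.le
    calc Real.exp 1 ^ 4 ≤ 2.7182818286 ^ 4 := by gcongr
      _ ≤ 55 := by norm_num
  calc _ ≤ (24 * Real.exp 1 / y ^ 2) ^ t * (Real.exp 1 ^ 3 * y ^ 3) ^ t := by
        refine mul_le_mul h1 h2 (by positivity) (by positivity)
    _ = (24 * Real.exp 1 ^ 4 * y) ^ t := by
        rw [← mul_pow]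
        congr 1
        field_simp
    _ ≤ _ := by
        gcongr
        calc 24 * Real.exp 1 ^ 4 * y ≤ 24 * 55 * (35 / 10 ^ 6) := by gcongr
          _ ≤ _ := by norm_num

variable {n : ℕ} {J : Type*} [Fintype J] [DecidableEq J]

omit [DecidableEq J] in
lemma linearCombination_clauseParity (F : J × Bool → Fin n × Fin n) (T : J → ZMod 2) (i : Fin n) :
    Fintype.linearCombination (ZMod 2) (clauseParity F) T i
      = (((Finset.univ.filter fun j => T j ≠ 0) ×ˢ (Finset.univ : Finset (Bool × Bool))).filter
          fun w => (if w.2.2 then (F (w.1, w.2.1)).1 else (F (w.1, w.2.1)).2) = i).card := by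
  rw [Fintype.linearCombination_apply, Finset.sum_apply, Finset.card_filter, Nat.cast_sum,
    Finset.sum_product, Finset.sum_filter]
  refine Finset.sum_congr rfl fun j _ => ?_
  have h01 : ∀ z : ZMod 2, z = 0 ∨ z = 1 := by decide
  rcases h01 (T j) with h | h
  · simp [h]
  · rw [h, one_smul, if_pos one_ne_zero]
    simp [clauseParity, Pi.single_apply, eq_comm (a := i), Fintype.sum_prod_type, -Finset.sum_boole]

omit [DecidableEq J] in
lemma exists_cover_of_not_expanding (F : J × Bool → Fin n × Fin n) (T : J → ZMod 2)
    (hT : hammingNorm (Fintype.linearCombination (ZMod 2) (clauseParity F) T) < hammingNorm T)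
    (hn : 5 * hammingNorm T / 2 ≤ n) :
    ∃ W : Finset (Fin n), W.card = 5 * hammingNorm T / 2 ∧
      ∀ q ∈ (Finset.univ.filter fun j => T j ≠ 0) ×ˢ (Finset.univ : Finset Bool),
        F q ∈ W ×ˢ W := by
  set S := (Finset.univ.filter fun j => T j ≠ 0) ×ˢ (Finset.univ : Finset (Bool × Bool)) with hS
  let g : J × Bool × Bool → Fin n :=
    fun w => if w.2.2 then (F (w.1, w.2.1)).1 else (F (w.1, w.2.1)).2
  have hlin : ∀ i, Fintype.linearCombination (ZMod 2) (clauseParity F) T i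
      = ((S.filter fun w => g w = i).card : ZMod 2) := linearCombination_clauseParity F T
  have hScard : S.card = 4 * hammingNorm T := by
    rw [hS, Finset.card_product]
    simp [hammingNorm, mul_comm]
  have hsum : S.card = ∑ i ∈ S.image g, (S.filter fun w => g w = i).card :=
    Finset.card_eq_sum_card_image g S
  have hterm : ∀ i ∈ S.image g, 2 ≤ (S.filter fun w => g w = i).card +
      if Fintype.linearCombination (ZMod 2) (clauseParity F) T i ≠ 0 then 1 else 0 := by
    intro i hi
    obtain ⟨w, hw, rfl⟩ := Finset.mem_image.1 hi
    have hpos : 0 < (S.filter fun w' => g w' = g w).card :=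
      Finset.card_pos.2 ⟨w, Finset.mem_filter.2 ⟨hw, rfl⟩⟩
    split_ifs with h
    · omega
    · rw [not_not, hlin, ZMod.natCast_eq_zero_iff] at h
      have := Nat.le_of_dvd hpos h
      omega
  have h2 : 2 * (S.image g).card ≤ 4 * hammingNorm T
      + hammingNorm (Fintype.linearCombination (ZMod 2) (clauseParity F) T) := by
    calc 2 * (S.image g).card = ∑ i ∈ S.image g, 2 := by simp [mul_comm]
      _ ≤ _ := Finset.sum_le_sum hterm
      _ = S.card + ∑ i ∈ S.image g,
          (if Fintype.linearCombination (ZMod 2) (clauseParity F) T i ≠ 0 then 1 else 0) := by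
        rw [Finset.sum_add_distrib, ← hsum]
      _ ≤ _ := by
        rw [hScard, ← Finset.card_filter]
        exact Nat.add_le_add_left (Finset.card_le_card
          (Finset.filter_subset_filter _ (Finset.subset_univ _))) _
  obtain ⟨W, hW, hWc⟩ := Finset.exists_superset_card_eq (s := S.image g)
    (n := 5 * hammingNorm T / 2) (by omega) (by simpa using hn)
  refine ⟨W, hWc, ?_⟩
  rintro ⟨j, b⟩ hq
  simp only [Finset.mem_product, Finset.mem_filter, Finset.mem_univ, true_and, and_true] at hq
  refine Finset.mem_product.2 ⟨hW ?_, hW ?_⟩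
  · exact Finset.mem_image.2 ⟨(j, b, true), by simp [hS, hq], by simp [g]⟩
  · exact Finset.mem_image.2 ⟨(j, b, false), by simp [hS, hq], by simp [g]⟩

/-- The clauses of `F` expand: small sums of clauses have large support. -/
def IsExpanding (R : ℕ) (F : J × Bool → Fin n × Fin n) : Prop :=
  ∀ T : J → ZMod 2, T ≠ 0 → hammingNorm T ≤ R →
    hammingNorm T ≤ hammingNorm (Fintype.linearCombination (ZMod 2) (clauseParity F) T)

open Classical in
lemma card_not_isExpanding_le {R : ℕ} (hJ : Fintype.card J = 8 * n)
    (hR : (R : ℝ) ≤ 4 / 10 ^ 10 * n) :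
    ((Finset.univ.filter fun F : J × Bool → Fin n × Fin n => ¬ IsExpanding R F).card : ℝ)
      ≤ 1 / 7 * Fintype.card (J × Bool → Fin n × Fin n) := by
  let A : Finset J → Finset (Fin n) → Finset (J × Bool → Fin n × Fin n) := fun S W =>
    Finset.univ.filter fun F => ∀ q ∈ S ×ˢ (Finset.univ : Finset Bool), F q ∈ W ×ˢ W
  have hsub : (Finset.univ.filter fun F : J × Bool → Fin n × Fin n => ¬ IsExpanding R F)
      ⊆ (Finset.Icc 1 R).biUnion fun t => (Finset.powersetCard t Finset.univ).biUnion fun S =>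
        (Finset.powersetCard (5 * t / 2) Finset.univ).biUnion fun W => A S W := by
    intro F hF
    simp only [Finset.mem_filter, Finset.mem_univ, true_and, IsExpanding, not_forall, not_le] at hF
    obtain ⟨T, hT0, hTR, hT⟩ := hF
    have hle : 5 * hammingNorm T / 2 ≤ n := by
      have h1 : (hammingNorm T : ℝ) ≤ 4 / 10 ^ 10 * n := le_trans (by exact_mod_cast hTR) hR
      have h2 : 5 * hammingNorm T ≤ n := by
        have : (5 * hammingNorm T : ℝ) ≤ n := by
          have : (0 : ℝ) ≤ n := Nat.cast_nonneg n
          linarith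
        exact_mod_cast this
      omega
    obtain ⟨W, hW, hFW⟩ := exists_cover_of_not_expanding F T hT hle
    simp only [Finset.mem_biUnion, Finset.mem_Icc, Finset.mem_powersetCard, Finset.subset_univ,
      true_and]
    refine ⟨hammingNorm T, ⟨?_, hTR⟩, Finset.univ.filter fun j => T j ≠ 0, rfl, W, hW, ?_⟩
    · exact hammingNorm_pos_iff.2 hT0
    · exact Finset.mem_filter.2 ⟨Finset.mem_univ _, hFW⟩
  set M := Fintype.card (J × Bool → Fin n × Fin n) with hM
  have hA : ∀ t S W, S.card = t → W.card = 5 * t / 2 → 1 ≤ t → t ≤ R →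
      ((A S W).card : ℝ) = ((5 * t / 2 : ℕ) / n : ℝ) ^ (4 * t) * M := by
    intro t S W hS hW ht htR
    have h := card_filter_forall_mem_mul (κ := Fin n × Fin n) (S ×ˢ (Finset.univ : Finset Bool))
      fun _ => W ×ˢ W
    rw [Finset.prod_const, ← Fintype.card_fun, ← hM, Finset.card_product, hS, Finset.card_product,
      hW, Fintype.card_prod, Fintype.card_fin, Finset.card_univ, Fintype.card_bool] at h
    have hn0 : (0 : ℝ) < n := by
      have : (1 : ℝ) ≤ R := by exact_mod_cast ht.trans htR
      linarith
    have h' : ((A S W).card : ℝ) * (n * n : ℝ) ^ (t * 2)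
        = (((5 * t / 2 : ℕ) : ℝ) * ((5 * t / 2 : ℕ) : ℝ)) ^ (t * 2) * M := by
      have := congrArg (Nat.cast : ℕ → ℝ) h
      push_cast at this ⊢
      convert this
    rw [div_pow, div_mul_eq_mul_div, eq_div_iff (by positivity)]
    rw [← sq, ← sq, ← pow_mul, ← pow_mul] at h'
    convert h' using 3 <;> ring
  calc ((Finset.univ.filter fun F : J × Bool → Fin n × Fin n => ¬ IsExpanding R F).card : ℝ)
      ≤ ∑ t ∈ Finset.Icc 1 R, ∑ S ∈ Finset.powersetCard t (Finset.univ : Finset J),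
        ∑ W ∈ Finset.powersetCard (5 * t / 2) (Finset.univ : Finset (Fin n)),
          ((A S W).card : ℝ) := by
        refine le_trans (Nat.cast_le.2 (Finset.card_le_card hsub)) ?_
        refine le_trans (Nat.cast_le.2 Finset.card_biUnion_le) ?_
        rw [Nat.cast_sum]
        refine Finset.sum_le_sum fun t _ => ?_
        refine le_trans (Nat.cast_le.2 Finset.card_biUnion_le) ?_
        rw [Nat.cast_sum]
        refine Finset.sum_le_sum fun S _ => ?_
        refine le_trans (Nat.cast_le.2 Finset.card_biUnion_le) ?_
        rw [Nat.cast_sum]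
    _ ≤ ∑ t ∈ Finset.Icc 1 R, (1 / 8 : ℝ) ^ t * M := by
        refine Finset.sum_le_sum fun t ht => ?_
        rw [Finset.mem_Icc] at ht
        have h1 : ∑ S ∈ Finset.powersetCard t (Finset.univ : Finset J),
            ∑ W ∈ Finset.powersetCard (5 * t / 2) (Finset.univ : Finset (Fin n)),
              ((A S W).card : ℝ)
            = ∑ S ∈ Finset.powersetCard t (Finset.univ : Finset J),
            ∑ W ∈ Finset.powersetCard (5 * t / 2) (Finset.univ : Finset (Fin n)),
              ((5 * t / 2 : ℕ) / n : ℝ) ^ (4 * t) * M :=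
          Finset.sum_congr rfl fun S hS => Finset.sum_congr rfl fun W hW =>
            hA t S W (Finset.mem_powersetCard.1 hS).2 (Finset.mem_powersetCard.1 hW).2 ht.1 ht.2
        rw [h1]
        simp only [Finset.sum_const, Finset.card_powersetCard, Finset.card_univ, hJ,
          Fintype.card_fin, nsmul_eq_mul]
        rw [← mul_assoc, ← mul_assoc]
        refine mul_le_mul_of_nonneg_right ?_ (Nat.cast_nonneg _)
        rw [mul_assoc]
        exact choose_mul_choose_mul_le ht.1 (le_trans (by exact_mod_cast ht.2) hR)
    _ ≤ 1 / 7 * M := by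
        rw [← Finset.sum_mul]
        refine mul_le_mul_of_nonneg_right ?_ (Nat.cast_nonneg _)
        have h := geom_sum_Ico_le_of_lt_one (x := (1 / 8 : ℝ)) (m := 1) (n := R + 1)
          (by norm_num) (by norm_num)
        refine (le_of_eq ?_).trans (h.trans (by norm_num))
        rfl

end Expansion

section Existence

variable {n s : ℕ} {J : Type*} [Fintype J]

lemma sum_pow_hammingDist [DecidableEq J] (a : J → ZMod 2) :
    ∑ β : J → ZMod 2, (1 / 3 : ℝ) ^ hammingDist a β = (4 / 3) ^ Fintype.card J := by
  calc ∑ β : J → ZMod 2, (1 / 3 : ℝ) ^ hammingDist a β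
      = ∑ β : J → ZMod 2, ∏ j, (if a j ≠ β j then (1 / 3 : ℝ) else 1) := by
        refine Finset.sum_congr rfl fun β _ => ?_
        rw [hammingDist, Finset.prod_ite, Finset.prod_const, Finset.prod_const_one, mul_one]
    _ = ∏ j, ∑ b : ZMod 2, (if a j ≠ b then (1 / 3 : ℝ) else 1) := by
        rw [Finset.prod_univ_sum, Fintype.piFinset_univ]
    _ = ∏ _j : J, (4 / 3 : ℝ) := by
        refine Finset.prod_congr rfl fun j _ => ?_
        have h : ∀ z : ZMod 2, ∑ b : ZMod 2, (if z ≠ b then (1 / 3 : ℝ) else 1) = 4 / 3 := by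
          intro z
          rw [Finset.sum_ite]
          have h1 : (Finset.univ.filter fun b => z ≠ b).card = 1 := by revert z; decide
          have h2 : (Finset.univ.filter fun b => ¬ z ≠ b).card = 1 := by revert z; decide
          rw [Finset.sum_const, Finset.sum_const, h1, h2]
          norm_num
        exact h _
    _ = _ := by rw [Finset.prod_const, Finset.card_univ]

lemma exists_far_point {Y : Type*} [Fintype Y] (hY : Fintype.card Y = 2 ^ n)
    (hJ : Fintype.card J = 8 * n) (a : Y → J → ZMod 2) :
    ∃ β : J → ZMod 2, ∀ y, 2 * n ≤ hammingDist (a y) β := by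
  classical
  by_contra! h
  have h1 : ∀ β : J → ZMod 2, 3 * (1 / 9 : ℝ) ^ n ≤ ∑ y, (1 / 3 : ℝ) ^ hammingDist (a y) β := by
    intro β
    obtain ⟨y, hy⟩ := h β
    calc 3 * (1 / 9 : ℝ) ^ n = (1 / 3 : ℝ) ^ (2 * n - 1) := by
          obtain ⟨k, rfl⟩ : ∃ k, n = k + 1 := ⟨n - 1, by omega⟩
          rw [show 2 * (k + 1) - 1 = 2 * k + 1 by omega, pow_succ, pow_succ, pow_mul]
          norm_num
          ring
      _ ≤ (1 / 3 : ℝ) ^ hammingDist (a y) β :=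
          pow_le_pow_of_le_one (by norm_num) (by norm_num) (by omega)
      _ ≤ _ := Finset.single_le_sum (f := fun y => (1 / 3 : ℝ) ^ hammingDist (a y) β)
          (fun _ _ => by positivity) (Finset.mem_univ y)
  have h2 : (2 : ℝ) ^ (8 * n) * (3 * (1 / 9 : ℝ) ^ n) ≤ 2 ^ n * (4 / 3) ^ (8 * n) := by
    calc (2 : ℝ) ^ (8 * n) * (3 * (1 / 9 : ℝ) ^ n)
        = ∑ _β : J → ZMod 2, 3 * (1 / 9 : ℝ) ^ n := by
          rw [Finset.sum_const, Finset.card_univ, Fintype.card_fun, ZMod.card, hJ, nsmul_eq_mul]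
          push_cast
          ring
      _ ≤ ∑ β : J → ZMod 2, ∑ y, (1 / 3 : ℝ) ^ hammingDist (a y) β :=
          Finset.sum_le_sum fun β _ => h1 β
      _ = _ := by
          rw [Finset.sum_comm]
          simp_rw [sum_pow_hammingDist]
          rw [Finset.sum_const, Finset.card_univ, hY, hJ, nsmul_eq_mul]
          push_cast
          ring
  rw [pow_mul, pow_mul, mul_left_comm, ← mul_pow, ← mul_pow] at h2
  have h3 : (2 * (4 / 3) ^ 8 : ℝ) ^ n ≤ (2 ^ 8 * (1 / 9)) ^ n :=
    pow_le_pow_left₀ (by norm_num) (by norm_num) n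
  have h4 : (0 : ℝ) < (2 ^ 8 * (1 / 9)) ^ n := by positivity
  linarith

lemma IsPM.exists_zmodSign {ι : Type*} {x : ι → ℝ} (hx : IsPM x) :
    ∃ y : ι → ZMod 2, x = fun i => zmodSign (y i) := by
  refine ⟨fun i => if x i = 1 then 0 else 1, funext fun i => ?_⟩
  rcases hx i with h | h <;> norm_num [zmodSign, h]

lemma zmodSign_injective : Function.Injective zmodSign := by
  intro z w h
  by_contra hne
  have h2 : ∀ z w : ZMod 2, z ≠ w → z + w = 1 := by decide
  have h3 := zmodSign_add z w
  rw [h2 z w hne, h, zmodSign_mul_self] at h3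
  norm_num [zmodSign] at h3

/-- Some choice of signs is violated on many clauses by every assignment. -/
lemma exists_signs_violated (hJ : Fintype.card J = 8 * n) (F : J × Bool → Fin n × Fin n) :
    ∃ β : J → ZMod 2, ∀ x : Fin n → ℝ, IsPM x →
      2 * n ≤ (Finset.univ.filter fun j => clauseProd x F j ≠ zmodSign (β j)).card := by
  obtain ⟨β, hβ⟩ := exists_far_point (n := n) (Y := Fin n → ZMod 2) (by simp) hJ fun y j =>
    (y (F (j, true)).1 + y (F (j, true)).2) + (y (F (j, false)).1 + y (F (j, false)).2)
  refine ⟨β, fun x hx => ?_⟩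
  obtain ⟨y, rfl⟩ := hx.exists_zmodSign
  refine (hβ y).trans (Finset.card_le_card fun j hj => ?_)
  simpa only [clauseProd, ← zmodSign_add, Finset.mem_filter, Finset.mem_univ, true_and, ne_eq,
    zmodSign_injective.eq_iff] using hj

/-- Some instance expands and has few collisions. -/
lemma exists_isExpanding [DecidableEq J] {R : ℕ} (hn : 0 < n) (hs : 0 < s)
    (hJ : Fintype.card J = 8 * n) (hR : (R : ℝ) ≤ 4 / 10 ^ 10 * n) :
    ∃ F : J × Bool → Fin n × Fin n, IsExpanding R F ∧
      (hitCollisions s F : ℝ) * n ^ 2 ≤ 544 * s ^ 4 * (n ^ s * n ^ s) := by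
  classical
  by_contra! h
  have hn0 : (0 : ℝ) < n := by exact_mod_cast hn
  have hs0 : (0 : ℝ) < s := by exact_mod_cast hs
  set A : ℝ := 544 * s ^ 4 * (n ^ s * n ^ s) with hA
  have hA0 : 0 < A := by positivity
  set N : ℝ := (Fintype.card (J × Bool → Fin n × Fin n) : ℝ) with hN
  have hN0 : 0 < N := by
    have : Nonempty (Fin n) := ⟨⟨0, hn⟩⟩
    exact Nat.cast_pos.2 Fintype.card_pos
  have h1 : N ≤ ∑ F : J × Bool → Fin n × Fin n,
      ((if ¬ IsExpanding R F then 1 else 0) + (hitCollisions s F : ℝ) * n ^ 2 / A) := by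
    rw [hN, ← Finset.card_univ, Finset.card_eq_sum_ones, Nat.cast_sum]
    refine Finset.sum_le_sum fun F _ => ?_
    by_cases hF : IsExpanding R F
    · have := h F hF
      rw [if_neg (not_not.2 hF), zero_add, Nat.cast_one, le_div_iff₀ hA0, one_mul]
      exact this.le
    · rw [if_pos hF, Nat.cast_one]
      exact le_add_of_nonneg_right (by positivity)
  have h2 := card_not_isExpanding_le (n := n) (J := J) hJ hR
  have h3 : (∑ F : J × Bool → Fin n × Fin n, (hitCollisions s F : ℝ)) * n ^ 4
      ≤ 272 * s ^ 4 * n ^ 2 * ((n ^ s * n ^ s) * N) := by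
    have := sum_hitCollisions_mul_le (n := n) (s := s) (J := J)
    rw [hJ] at this
    have : (((∑ F : J × Bool → Fin n × Fin n, hitCollisions s F) * n ^ 4 : ℕ) : ℝ)
      ≤ (((s ^ 4 * (2 * (8 * n)) ^ 2 + s ^ 4 * (2 * (8 * n)) * n) *
        ((n ^ s * n ^ s) * Fintype.card (J × Bool → Fin n × Fin n)) : ℕ) : ℝ) := by
      exact_mod_cast this
    push_cast at this
    refine this.trans (le_of_eq ?_)
    rw [hN]
    ring
  have h4 : ∑ F : J × Bool → Fin n × Fin n, (hitCollisions s F : ℝ) * n ^ 2 / A ≤ N / 2 := by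
    rw [← Finset.sum_div, ← Finset.sum_mul, div_le_iff₀ hA0]
    refine le_of_mul_le_mul_right ?_ (show (0 : ℝ) < n ^ 2 by positivity)
    calc _ = (∑ F : J × Bool → Fin n × Fin n, (hitCollisions s F : ℝ)) * n ^ 4 := by ring
      _ ≤ _ := h3
      _ = _ := by rw [hA]; ring
  rw [Finset.sum_add_distrib, Finset.sum_boole] at h1
  have h5 : N ≤ 1 / 7 * N + N / 2 := h1.trans (add_le_add h2 h4)
  linarith

end Existence

section Projection

variable {X κ : Type*} [Fintype X] [DecidableEq X] [Fintype κ]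

/-- The projection onto the vectors invariant under the signed permutation `σ · τ`. -/
noncomputable def signedProj (τ : X → X) (σ : X → ℝ) : Matrix X X ℝ :=
  fun I J => ((if J = I then 1 else 0) + σ I * (if J = τ I then 1 else 0)) / 2

variable {τ : X → X} {σ : X → ℝ}

lemma sum_signedProj_mul (f : X → ℝ) (I : X) :
    ∑ J, signedProj τ σ I J * f J = (f I + σ I * f (τ I)) / 2 := by
  simp only [signedProj, div_mul_eq_mul_div, add_mul, mul_assoc, ite_mul, one_mul, zero_mul,
    ← Finset.sum_div, Finset.sum_add_distrib, ← Finset.mul_sum, Finset.sum_ite_eq',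
    Finset.mem_univ, if_true]

lemma signedProj_mul_self (hτ : ∀ I, τ (τ I) = I) (hσ : ∀ I, σ I * σ (τ I) = 1) :
    signedProj τ σ * signedProj τ σ = signedProj τ σ := by
  ext I L
  rw [Matrix.mul_apply, sum_signedProj_mul]
  simp only [signedProj, hτ]
  linear_combination ((if L = I then 1 else 0 : ℝ) / 4) * hσ I

omit [Fintype X] in
lemma signedProj_transpose (hτ : ∀ I, τ (τ I) = I) (hσ : ∀ I, σ (τ I) = σ I) :
    (signedProj τ σ).transpose = signedProj τ σ := by
  ext I J
  have h1 : (I = τ J) = (J = τ I) :=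
    propext ⟨fun h => by rw [h, hτ], fun h => by rw [h, hτ]⟩
  simp only [Matrix.transpose_apply, signedProj, h1, eq_comm (a := I) (b := J)]
  split_ifs with h2 h3 h3
  · rw [h2]
  · rw [h2]
  · rw [h3, hσ]
  · simp

/-- The tensor power of a square matrix. -/
def tensorPow (κ : Type*) [Fintype κ] (A : Matrix X X ℝ) : Matrix (κ → X) (κ → X) ℝ :=
  fun I J => ∏ g, A (I g) (J g)

omit [Fintype X] [DecidableEq X] in
lemma tensorPow_transpose (A : Matrix X X ℝ) :
    (tensorPow κ A).transpose = tensorPow κ A.transpose := rfl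

omit [DecidableEq X] in
lemma tensorPow_mul [DecidableEq κ] (A B : Matrix X X ℝ) :
    tensorPow κ A * tensorPow κ B = tensorPow κ (A * B) := by
  ext I L
  simp only [Matrix.mul_apply, tensorPow, ← Finset.prod_mul_distrib]
  rw [Finset.prod_univ_sum, Fintype.piFinset_univ]

omit [DecidableEq X] in
lemma sum_tensorPow [DecidableEq κ] (A : Matrix X X ℝ) (f : X → ℝ) :
    ∑ I, ∑ J, (∏ g, f (I g)) * tensorPow κ A I J * ∏ g, f (J g)
      = (∑ I, f I * ∑ J, A I J * f J) ^ Fintype.card κ := by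
  calc ∑ I, ∑ J, (∏ g, f (I g)) * tensorPow κ A I J * ∏ g, f (J g)
      = ∑ I : κ → X, ∏ g, f (I g) * ∑ J, A (I g) J * f J := by
        refine Finset.sum_congr rfl fun I _ => ?_
        rw [Finset.prod_mul_distrib, Finset.prod_univ_sum, Fintype.piFinset_univ, Finset.mul_sum]
        simp only [tensorPow, Finset.prod_mul_distrib, mul_assoc]
    _ = _ := by
        have h := Finset.prod_univ_sum (fun _ : κ => (Finset.univ : Finset X))
          fun _ I => f I * ∑ J, A I J * f J
        rw [Fintype.piFinset_univ, Finset.prod_const, Finset.card_univ] at h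
        exact h.symm

omit [DecidableEq X] in
lemma sum_mul_sum_nonneg {A : Matrix X X ℝ} (hT : A.transpose = A) (hA : A * A = A) (f : X → ℝ) :
    0 ≤ ∑ I, f I * ∑ J, A I J * f J := by
  change 0 ≤ f ⬝ᵥ A.mulVec f
  rw [← hA, ← Matrix.mulVec_mulVec, Matrix.dotProduct_mulVec, ← Matrix.mulVec_transpose, hT]
  exact Finset.sum_nonneg fun _ _ => mul_self_nonneg _

/-- A complexified real orthogonal projection lies between `0` and `1`. -/
lemma posSemidef_map_ofReal {ι : Type*} [Fintype ι] [DecidableEq ι] {N : Matrix ι ι ℝ}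
    (hT : N.transpose = N) (hN : N * N = N) :
    (N.map Complex.ofReal).PosSemidef ∧ (1 - N.map Complex.ofReal).PosSemidef := by
  have h1 : (N.map Complex.ofReal).conjTranspose = N.map Complex.ofReal := by
    conv_rhs => rw [← hT]
    ext i j
    simp [Matrix.conjTranspose_apply]
  have h2 : N.map Complex.ofReal * N.map Complex.ofReal = N.map Complex.ofReal := by
    conv_rhs => rw [← hN]
    ext i j
    simp [Matrix.mul_apply]
  constructor
  · have := Matrix.posSemidef_conjTranspose_mul_self (N.map Complex.ofReal)
    rwa [h1, h2] at this
  · have := Matrix.posSemidef_conjTranspose_mul_self (1 - N.map Complex.ofReal)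
    rwa [Matrix.conjTranspose_sub, Matrix.conjTranspose_one, h1, mul_sub, mul_one, sub_mul, h2,
      one_mul, sub_self, sub_zero] at this

end Projection

section Blocks

variable {n s K : ℕ}

/-- Cut a pair of `K * s`-tuples into `K` pairs of `s`-tuples. -/
def blocks (n s K : ℕ) : ((Fin (K * s) → Fin n) × (Fin (K * s) → Fin n)) ≃
    (Fin K → (Fin s → Fin n) × (Fin s → Fin n)) :=
  (Equiv.prodCongr
    ((finProdFinEquiv.symm.arrowCongr (Equiv.refl _)).trans (Equiv.curry _ _ _))
    ((finProdFinEquiv.symm.arrowCongr (Equiv.refl _)).trans (Equiv.curry _ _ _))).trans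
  (Equiv.arrowProdEquivProdArrow _ _ _).symm

lemma prod_mul_prod_eq_prod_tupleProd {R : Type*} [CommMonoid R] (z : Fin n → R)
    (p : (Fin (K * s) → Fin n) × (Fin (K * s) → Fin n)) :
    (∏ r, z (p.1 r)) * ∏ r, z (p.2 r) = ∏ g, tupleProd z (blocks n s K p g) := by
  have h : ∀ f : Fin (K * s) → Fin n,
      ∏ r, z (f r) = ∏ g, ∏ r, z (f (finProdFinEquiv (g, r))) := fun f => by
    rw [← Fintype.prod_prod_type' (f := fun g r => z (f (finProdFinEquiv (g, r))))]
    exact (Equiv.prod_comp finProdFinEquiv fun r => z (f r)).symm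
  rw [h, h, ← Finset.prod_mul_distrib]
  rfl

/-- The verifier acting as `A` on every block. -/
noncomputable def blockMatrix (A : Matrix ((Fin s → Fin n) × (Fin s → Fin n))
    ((Fin s → Fin n) × (Fin s → Fin n)) ℝ) (K : ℕ) :
    Matrix ((Fin (K * s) → Fin n) × (Fin (K * s) → Fin n))
      ((Fin (K * s) → Fin n) × (Fin (K * s) → Fin n)) ℂ :=
  ((tensorPow (Fin K) A).submatrix (blocks n s K) (blocks n s K)).map Complex.ofReal

variable {A : Matrix ((Fin s → Fin n) × (Fin s → Fin n)) ((Fin s → Fin n) × (Fin s → Fin n)) ℝ}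

lemma posSemidef_blockMatrix (hT : A.transpose = A) (hA : A * A = A) :
    (blockMatrix A K).PosSemidef ∧ (1 - blockMatrix A K).PosSemidef := by
  refine posSemidef_map_ofReal ?_ ?_
  · rw [Matrix.transpose_submatrix, tensorPow_transpose, hT]
  · rw [Matrix.submatrix_mul_equiv, tensorPow_mul, hA]

lemma acceptProb_blockMatrix (x : Fin n → ℝ) :
    acceptProb n (K * s) (blockMatrix A K) x
      = (((n : ℝ) ^ (2 * s))⁻¹ * ∑ I, tupleProd x I * ∑ J, A I J * tupleProd x J) ^ K := by
  have h1 : ∀ p, psiTensor n (K * s) x p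
      = ((((n : ℝ) ^ (K * s))⁻¹ * ∏ g, tupleProd x (blocks n s K p g) : ℝ) : ℂ) := by
    intro p
    rw [psiTensor, psiVec, psiVec, mul_mul_mul_comm, prod_mul_prod_eq_prod_tupleProd, ← mul_inv,
      Real.mul_self_sqrt (by positivity)]
  have h2 : acceptProb n (K * s) (blockMatrix A K) x = (((n : ℝ) ^ (K * s))⁻¹) ^ 2 *
      ∑ I, ∑ J, (∏ g, tupleProd x (I g)) * tensorPow (Fin K) A I J * ∏ g, tupleProd x (J g) := by
    rw [acceptProb, ← Equiv.sum_comp (blocks n s K), Complex.re_sum, Finset.mul_sum]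
    refine Finset.sum_congr rfl fun p _ => ?_
    rw [← Equiv.sum_comp (blocks n s K), Complex.re_sum, Finset.mul_sum]
    refine Finset.sum_congr rfl fun q _ => ?_
    rw [h1, h1, Complex.conj_ofReal, blockMatrix, Matrix.map_apply, Matrix.submatrix_apply,
      ← Complex.ofReal_mul, ← Complex.ofReal_mul, Complex.ofReal_re]
    ring
  rw [h2, sum_tensorPow, Fintype.card_fin, mul_pow, ← inv_pow, ← inv_pow, ← pow_mul, ← pow_mul]
  congr 2
  ring

lemma map_acceptPoly_blockMatrix (E : MvPolynomial (Fin n) ℝ →ₗ[ℝ] ℝ) :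
    E (acceptPoly n (K * s) (blockMatrix A K)) = ((n : ℝ) ^ (2 * (K * s)))⁻¹ *
      ∑ I, ∑ J, tensorPow (Fin K) A I J *
        E ((∏ g, tupleProd X (I g)) * ∏ g, tupleProd X (J g)) := by
  let G : ((Fin (K * s) → Fin n) × (Fin (K * s) → Fin n)) →
      ((Fin (K * s) → Fin n) × (Fin (K * s) → Fin n)) → ℝ := fun p q =>
    ((n : ℝ) ^ (2 * (K * s)))⁻¹ * (tensorPow (Fin K) A (blocks n s K p) (blocks n s K q) *
      E ((∏ g, tupleProd X (blocks n s K p g)) * ∏ g, tupleProd X (blocks n s K q g)))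
  have h1 : E (acceptPoly n (K * s) (blockMatrix A K))
      = ∑ I, ∑ J, ∑ K', ∑ L, G (I, K') (J, L) := by
    rw [acceptPoly, map_sum]
    refine Finset.sum_congr rfl fun I _ => ?_
    rw [map_sum]
    refine Finset.sum_congr rfl fun J _ => ?_
    rw [map_sum]
    refine Finset.sum_congr rfl fun K' _ => ?_
    rw [map_sum]
    refine Finset.sum_congr rfl fun L _ => ?_
    have h3 : ∀ a b c d : MvPolynomial (Fin n) ℝ, a * b * c * d = (a * c) * (b * d) :=
      fun a b c d => by ring
    rw [C_mul', map_smul, smul_eq_mul, mul_assoc, h3]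
    simp only [G]
    rw [← prod_mul_prod_eq_prod_tupleProd, ← prod_mul_prod_eq_prod_tupleProd]
    rfl
  have h2 : ∑ I, ∑ J, ∑ K', ∑ L, G (I, K') (J, L) = ∑ p, ∑ q, G p q := by
    simp only [Fintype.sum_prod_type]
    exact Finset.sum_congr rfl fun I _ => Finset.sum_comm
  rw [h1, h2, ← Equiv.sum_comp (blocks n s K), Finset.mul_sum]
  refine Finset.sum_congr rfl fun p _ => ?_
  rw [← Equiv.sum_comp (blocks n s K), Finset.mul_sum]

end Blocks

section Verifier

variable {n s : ℕ} {J : Type*} [Fintype J]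

/-- One block of the verifier: test the clause hit by `I` against the signs `β`. -/
noncomputable def verifier (s : ℕ) (F : J × Bool → Fin n × Fin n) (β : J → ZMod 2) :
    Matrix ((Fin s → Fin n) × (Fin s → Fin n)) ((Fin s → Fin n) × (Fin s → Fin n)) ℝ :=
  signedProj (swapTuple F) fun I =>
    zmodSign (Fintype.linearCombination (ZMod 2) β (swapClause F I))

variable (F : J × Bool → Fin n × Fin n) (β : J → ZMod 2)

lemma verifier_transpose : (verifier s F β).transpose = verifier s F β :=
  signedProj_transpose (swapTuple_swapTuple F) fun I => by rw [swapClause_swapTuple]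

lemma verifier_mul_self : verifier s F β * verifier s F β = verifier s F β :=
  signedProj_mul_self (swapTuple_swapTuple F) fun I => by
    rw [swapClause_swapTuple, zmodSign_mul_self]

lemma IsPM.tupleProd_eq {x : Fin n → ℝ} (hx : IsPM x) (I : (Fin s → Fin n) × (Fin s → Fin n)) :
    tupleProd x I = 1 ∨ tupleProd x I = -1 := by
  have hsq : tupleProd x I ^ 2 = 1 := by
    have h : ∀ i, x i ^ 2 = 1 := fun i => by rcases hx i with h | h <;> norm_num [h]
    rw [tupleProd, mul_pow, ← Finset.prod_pow, ← Finset.prod_pow]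
    simp [h]
  exact mul_self_eq_one_iff.1 (sq (tupleProd x I) ▸ hsq)

open Classical in
lemma sum_verifier_le {x : Fin n → ℝ} (hx : IsPM x) :
    ∑ I, tupleProd x I * ∑ I', verifier s F β I I' * tupleProd x I'
      ≤ (n : ℝ) ^ (2 * s) - (Finset.univ.filter fun I : (Fin s → Fin n) × (Fin s → Fin n) =>
        ∃ h, IsGoodHit F I h ∧ clauseProd x F h.2.1 ≠ zmodSign (β h.2.1)).card := by
  have hcard : (n : ℝ) ^ (2 * s) = ∑ _I : (Fin s → Fin n) × (Fin s → Fin n), (1 : ℝ) := by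
    simp [two_mul, pow_add]
  have hsq : ∀ i, x i * x i = 1 := fun i => by rcases hx i with h | h <;> norm_num [h]
  rw [hcard, ← Finset.sum_boole, ← Finset.sum_sub_distrib]
  refine Finset.sum_le_sum fun I _ => ?_
  rw [verifier, sum_signedProj_mul]
  split_ifs with hI
  · obtain ⟨h, hh, hV⟩ := hI
    have h1 := hh.1.1.tupleProd_mul x hsq
    rw [← hh.swapTuple_eq] at h1
    rw [← h1] at hV
    rw [hh.swapClause_eq, Fintype.linearCombination_apply_single, one_smul]
    have h2 : zmodSign (β h.2.1) = 1 ∨ zmodSign (β h.2.1) = -1 := by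
      unfold zmodSign; split_ifs <;> simp
    rcases hx.tupleProd_eq I with a | a <;> rcases hx.tupleProd_eq (swapTuple F I) with b | b <;>
      rcases h2 with c | c <;> rw [a, b, c] at hV ⊢ <;>
      first | (norm_num; done) | norm_num at hV
  · have h2 : ∀ z, zmodSign z = 1 ∨ zmodSign z = -1 := fun z => by
      unfold zmodSign; split_ifs <;> simp
    rcases hx.tupleProd_eq I with a | a <;> rcases hx.tupleProd_eq (swapTuple F I) with b | b <;>
      rcases h2 (Fintype.linearCombination (ZMod 2) β (swapClause F I)) with c | c <;>
      rw [a, b, c] <;> norm_num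

lemma tupleProd_X (I : (Fin s → Fin n) × (Fin s → Fin n)) :
    ∃ α : Fin n →₀ ℕ, parity α = tupleParity I ∧
      tupleProd (X : Fin n → MvPolynomial (Fin n) ℝ) I = monomial α 1 := by
  refine ⟨∑ r, Finsupp.single (I.1 r) 1 + ∑ r, Finsupp.single (I.2 r) 1, ?_, ?_⟩
  · simp only [map_add, map_sum, parity_single, tupleParity]
  · simp only [tupleProd, X, ← monomial_sum_one, monomial_mul, one_mul]

open Classical in
lemma sum_verifier_mul_pseudoExpectation {D K : ℕ} (hK : K ≤ D)
    (E : MvPolynomial (Fin n) ℝ →ₗ[ℝ] ℝ)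
    (hE : ∀ (α : Fin n →₀ ℕ) (T : J → ZMod 2), hammingNorm T ≤ D →
      Fintype.linearCombination (ZMod 2) (clauseParity F) T = parity α →
        E (monomial α 1) = zmodSign (Fintype.linearCombination (ZMod 2) β T))
    (I : Fin K → (Fin s → Fin n) × (Fin s → Fin n)) :
    ∑ I', tensorPow (Fin K) (verifier s F β) I I' *
      E ((∏ g, tupleProd X (I g)) * ∏ g, tupleProd X (I' g)) = 1 := by
  let Q : (Fin s → Fin n) × (Fin s → Fin n) → (Fin s → Fin n) × (Fin s → Fin n) → ℝ :=
    fun A B => ((if B = A then 1 else 0) + (if B = swapTuple F A then 1 else 0)) / 2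
  have hQ : ∀ A, ∑ B, Q A B = 1 := fun A => by
    simp only [Q, ← Finset.sum_div, Finset.sum_add_distrib, Finset.sum_ite_eq', Finset.mem_univ,
      if_true]
    norm_num
  have hterm : ∀ I' : Fin K → (Fin s → Fin n) × (Fin s → Fin n),
      tensorPow (Fin K) (verifier s F β) I I' *
        E ((∏ g, tupleProd X (I g)) * ∏ g, tupleProd X (I' g)) = ∏ g, Q (I g) (I' g) := by
    intro I'
    by_cases hII : ∀ g, I' g = I g ∨ I' g = swapTuple F (I g)
    · let t : Fin K → J → ZMod 2 := fun g => if I' g = I g then 0 else swapClause F (I g)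
      have ht1 : ∀ g, hammingNorm (t g) ≤ 1 := fun g => by
        simp only [t]
        split_ifs
        · simp
        · exact hammingNorm_swapClause_le F (I g)
      have ht2 : hammingNorm (∑ g, t g) ≤ D := by
        refine le_trans ?_ hK
        calc hammingNorm (∑ g, t g) ≤ ∑ g, hammingNorm (t g) :=
              Finset.le_sum_of_subadditive _ hammingNorm_zero.le hammingNorm_add_le' _ _
          _ ≤ ∑ _g : Fin K, 1 := Finset.sum_le_sum fun g _ => ht1 g
          _ = K := by simp
      have ht3 : ∀ g, Fintype.linearCombination (ZMod 2) (clauseParity F) (t g)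
          = tupleParity (I g) + tupleParity (I' g) := fun g => by
        simp only [t]
        split_ifs with h
        · rw [h, map_zero]
          exact funext fun k => (CharTwo.add_self_eq_zero (tupleParity (I g) k)).symm
        · rw [(hII g).resolve_left h, tupleParity_add_swapTuple]
      have ht4 : ∀ g, verifier s F β (I g) (I' g) *
          zmodSign (Fintype.linearCombination (ZMod 2) β (t g)) = Q (I g) (I' g) := fun g => by
        simp only [t, Q, verifier, signedProj]
        by_cases h : I' g = I g
        · rw [if_pos h, if_pos h, map_zero, zmodSign_zero, mul_one]
          by_cases h' : swapTuple F (I g) = I g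
          · rw [swapClause_eq_zero h', map_zero, zmodSign_zero, one_mul]
          · rw [if_neg (fun h'' => h' (h''.symm.trans h)), mul_zero]
        · rw [if_neg h, if_neg h, if_pos ((hII g).resolve_left h), zero_add, zero_add, mul_one,
            div_mul_eq_mul_div, zmodSign_mul_self]
      choose α hα hα' using fun A : (Fin s → Fin n) × (Fin s → Fin n) => tupleProd_X A
      have hmon : (∏ g, tupleProd X (I g)) * ∏ g, tupleProd X (I' g)
          = monomial (∑ g, (α (I g) + α (I' g))) (1 : ℝ) := by
        simp only [hα', ← monomial_sum_one, monomial_mul, one_mul, Finset.sum_add_distrib]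
      have hsign : ∀ S : Finset (Fin K),
          zmodSign (Fintype.linearCombination (ZMod 2) β (∑ g ∈ S, t g))
            = ∏ g ∈ S, zmodSign (Fintype.linearCombination (ZMod 2) β (t g)) := by
        intro S
        induction S using Finset.induction_on with
        | empty => simp [zmodSign_zero]
        | insert g S hg ih =>
          rw [Finset.sum_insert hg, Finset.prod_insert hg, map_add, zmodSign_add, ih]
      rw [hmon, hE _ (∑ g, t g) ht2 (by simp only [map_sum, map_add, ht3, hα]), hsign, tensorPow,
        ← Finset.prod_mul_distrib]
      exact Finset.prod_congr rfl fun g _ => ht4 g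
    · push Not at hII
      obtain ⟨g, hg1, hg2⟩ := hII
      rw [tensorPow, Finset.prod_eq_zero (Finset.mem_univ g), zero_mul,
        Finset.prod_eq_zero (Finset.mem_univ g)]
      · simp [Q, hg1, hg2]
      · simp [verifier, signedProj, hg1, hg2]
  rw [Finset.sum_congr rfl fun I' _ => hterm I']
  have h := Finset.prod_univ_sum (fun _ : Fin K => Finset.univ) fun g B => Q (I g) B
  rw [Fintype.piFinset_univ] at h
  rw [← h]
  simp [hQ]

end Verifier

open Classical in
lemma one_div_le_card_violated {n s : ℕ} {J : Type*} [Fintype J] (hn : 0 < n)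
    (hs : 1024 * s ^ 2 ≤ n) (hns : n ≤ 4096 * s ^ 2) {F : J × Bool → Fin n × Fin n}
    (hF : (hitCollisions s F : ℝ) * n ^ 2 ≤ 544 * s ^ 4 * (n ^ s * n ^ s)) {V : J → Prop}
    (hV : 2 * n ≤ (Finset.univ.filter V).card) :
    1 / 2048 * (n : ℝ) ^ (2 * s) ≤
      (Finset.univ.filter fun I : (Fin s → Fin n) × (Fin s → Fin n) =>
        ∃ h, IsGoodHit F I h ∧ V h.2.1).card := by
  have h1 := (Nat.mul_le_mul_right (n ^ s * n ^ s) (Nat.mul_le_mul_left (s ^ 2)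
    (Nat.mul_le_mul_left 2 hV))).trans (card_violated_le F V)
  set g := (Finset.univ.filter fun I : (Fin s → Fin n) × (Fin s → Fin n) =>
    ∃ h, IsGoodHit F I h ∧ V h.2.1).card
  have h2 : (s : ℝ) ^ 2 * (2 * (2 * n)) * (n ^ s * n ^ s)
      ≤ n ^ 2 * (g + 2 * hitCollisions s F) := by exact_mod_cast h1
  have hs' : 1024 * (s : ℝ) ^ 2 ≤ n := by exact_mod_cast hs
  have hns' : (n : ℝ) ≤ 4096 * s ^ 2 := by exact_mod_cast hns
  have hn' : (0 : ℝ) < n := by exact_mod_cast hn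
  have hN : (n : ℝ) ^ (2 * s) = n ^ s * n ^ s := by rw [two_mul, pow_add]
  rw [hN]
  set N : ℝ := (n : ℝ) ^ s * n ^ s
  have hN0 : 0 < N := by positivity
  have h3 : 1088 * (s : ℝ) ^ 4 * N ≤ 2 * s ^ 2 * n * N := by
    have : (1024 * (s : ℝ) ^ 2) * (s ^ 2 * N) ≤ n * (s ^ 2 * N) := by gcongr
    have : 0 ≤ (s : ℝ) ^ 2 * n * N := by positivity
    linarith
  have h4 : (n : ℝ) * (n * N) ≤ 4096 * s ^ 2 * (n * N) := by gcongr
  refine le_of_mul_le_mul_left ?_ (show (0 : ℝ) < n ^ 2 by positivity)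
  linarith

lemma exists_verifier {n s K D : ℕ} (hn : 0 < n) (hs : 1024 * s ^ 2 ≤ n) (hns : n ≤ 4096 * s ^ 2)
    (hK : K ≤ D) (hD : 2 * (D : ℝ) ≤ 4 / 10 ^ 10 * n) :
    ∃ M : Matrix ((Fin (K * s) → Fin n) × (Fin (K * s) → Fin n))
        ((Fin (K * s) → Fin n) × (Fin (K * s) → Fin n)) ℂ,
      M.PosSemidef ∧ (1 - M).PosSemidef ∧
      (∀ x : Fin n → ℝ, IsPM x → acceptProb n (K * s) M x ≤ (1 - 1 / 2048) ^ K) ∧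
      ∃ E : MvPolynomial (Fin n) ℝ →ₗ[ℝ] ℝ, E 1 = 1 ∧
        (∀ p : MvPolynomial (Fin n) ℝ, p.totalDegree ≤ D / 2 → 0 ≤ E (p ^ 2)) ∧
        (∀ (i : Fin n) (q : MvPolynomial (Fin n) ℝ), E ((X i ^ 2 - 1) * q) = 0) ∧
        E (acceptPoly n (K * s) M) = 1 := by
  classical
  have hs0 : 0 < s := by
    rcases Nat.eq_zero_or_pos s with rfl | h
    · omega
    · exact h
  have hn' : (0 : ℝ) < n := by exact_mod_cast hn
  have hpow : (0 : ℝ) < (n : ℝ) ^ (2 * s) := by positivity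
  obtain ⟨F, hexp, hcol⟩ := exists_isExpanding (n := n) (s := s) (J := Fin (8 * n)) (R := 2 * D)
    hn hs0 (Fintype.card_fin _) (by push_cast; exact hD)
  obtain ⟨β, hβ⟩ := exists_signs_violated (Fintype.card_fin _) F
  obtain ⟨E, hE1, hEsq, hEcube, hE⟩ := exists_pseudoExpectation (D := D)
    (Fintype.linearCombination (ZMod 2) (clauseParity F)).toAddMonoidHom
    (Fintype.linearCombination (ZMod 2) β).toAddMonoidHom hexp
  obtain ⟨hM0, hM1⟩ := posSemidef_blockMatrix (K := K) (verifier_transpose (s := s) F β)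
    (verifier_mul_self F β)
  refine ⟨blockMatrix (verifier s F β) K, hM0, hM1, fun x hx => ?_, E, hE1, hEsq, hEcube, ?_⟩
  · have hnonneg := sum_mul_sum_nonneg (verifier_transpose F β) (verifier_mul_self F β)
      (tupleProd (s := s) x)
    rw [acceptProb_blockMatrix]
    refine pow_le_pow_left₀ (mul_nonneg (by positivity) hnonneg) ?_ K
    rw [inv_mul_le_iff₀ hpow]
    refine (sum_verifier_le F β hx).trans ?_
    rw [mul_sub, mul_one, mul_comm _ (1 / 2048 : ℝ)]
    refine sub_le_sub_left ?_ _
    refine (one_div_le_card_violated hn hs hns hcol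
      (V := fun j => clauseProd x F j ≠ zmodSign (β j)) (by convert hβ x hx)).trans (le_of_eq ?_)
    congr!
  · have h1 := sum_verifier_mul_pseudoExpectation (s := s) F β hK E hE
    rw [map_acceptPoly_blockMatrix, Finset.sum_congr rfl fun I _ => h1 I, Finset.sum_const,
      Finset.card_univ, nsmul_eq_mul, mul_one]
    have h2 : (Fintype.card (Fin K → (Fin s → Fin n) × (Fin s → Fin n)) : ℝ)
        = (n : ℝ) ^ (2 * (K * s)) := by
      simp only [Fintype.card_fun, Fintype.card_prod, Fintype.card_fin]
      push_cast
      rw [← pow_add, ← pow_mul]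
      congr 1
      ring
    rw [h2, inv_mul_cancel₀ (by positivity)]

/-- integrality gap for QMA(2)-Honest. -/
theorem qma2_honest_integrality_gap (ε : ℝ) (hε : 0 < ε) :
    ∃ (c : ℝ) (e : ℕ) (n₀ : ℕ), 0 < c ∧
      ∀ n : ℕ, n₀ ≤ n →
        ∃ m : ℕ, (m : ℝ) ≤ Real.sqrt n * (Real.log n) ^ e ∧
          ∃ M : Matrix ((Fin m → Fin n) × (Fin m → Fin n))
              ((Fin m → Fin n) × (Fin m → Fin n)) ℂ,
            M.PosSemidef ∧ (1 - M).PosSemidef ∧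
            (∀ x : Fin n → ℝ, IsPM x → acceptProb n m M x ≤ ε) ∧
            ∃ E : MvPolynomial (Fin n) ℝ →ₗ[ℝ] ℝ,
              E 1 = 1 ∧
              (∀ p : MvPolynomial (Fin n) ℝ,
                p.totalDegree ≤ ⌈c * n⌉₊ / 2 → 0 ≤ E (p ^ 2)) ∧
              (∀ (i : Fin n) (q : MvPolynomial (Fin n) ℝ),
                q.totalDegree ≤ ⌈c * n⌉₊ - 2 → E ((X i ^ 2 - 1) * q) = 0) ∧
              E (acceptPoly n m M) = 1 := by
  obtain ⟨K, hK⟩ := exists_pow_lt_of_lt_one hε (show (1 - 1 / 2048 : ℝ) < 1 by norm_num)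
  refine ⟨1 / 10 ^ 10, 1, max (10 ^ 10 * (K + 1)) ⌈Real.exp K⌉₊, by norm_num, fun n hn => ?_⟩
  have hn1 : 10 ^ 10 * (K + 1) ≤ n := (le_max_left _ _).trans hn
  have hn2 : Real.exp K ≤ n := (Nat.le_ceil _).trans (by exact_mod_cast (le_max_right _ _).trans hn)
  have hn3 : (10 : ℝ) ^ 10 * (K + 1) ≤ n := by exact_mod_cast hn1
  have hK0 : (0 : ℝ) ≤ K := Nat.cast_nonneg K
  have hpos : 0 < n := by omega
  set s := Nat.sqrt (n / 1024)
  have hs1 : s ^ 2 ≤ n / 1024 := Nat.sqrt_le' _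
  have hs2 : n / 1024 < (s + 1) ^ 2 := Nat.lt_succ_sqrt' _
  have hs : 1024 * s ^ 2 ≤ n := by omega
  have hs0 : 0 < s := Nat.sqrt_pos.2 (by omega)
  have hns : n ≤ 4096 * s ^ 2 := by
    have : (s + 1) ^ 2 ≤ (2 * s) ^ 2 := Nat.pow_le_pow_left (by omega) 2
    rw [mul_pow] at this
    omega
  have hKD : K ≤ ⌈(1 / 10 ^ 10 : ℝ) * n⌉₊ := by
    have h : (K : ℝ) ≤ ⌈(1 / 10 ^ 10 : ℝ) * n⌉₊ := le_trans (by linarith) (Nat.le_ceil _)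
    exact_mod_cast h
  have hD : 2 * (⌈(1 / 10 ^ 10 : ℝ) * n⌉₊ : ℝ) ≤ 4 / 10 ^ 10 * n := by
    have := (Nat.ceil_lt_add_one (show (0 : ℝ) ≤ 1 / 10 ^ 10 * n by positivity)).le
    linarith
  obtain ⟨M, hM0, hM1, hacc, E, hE1, hEsq, hEcube, hE⟩ := exists_verifier hpos hs hns hKD hD
  refine ⟨K * s, ?_, M, hM0, hM1, fun x hx => (hacc x hx).trans hK.le, E, hE1, hEsq,
    fun i q _ => hEcube i q, hE⟩
  have hsn : (s : ℝ) ≤ Real.sqrt n :=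
    Real.le_sqrt_of_sq_le (by exact_mod_cast (by omega : s ^ 2 ≤ n))
  have hlog : (K : ℝ) ≤ Real.log n := (Real.le_log_iff_exp_le (by exact_mod_cast hpos)).2 hn2
  rw [pow_one, Nat.cast_mul, mul_comm]
  exact mul_le_mul hsn hlog hK0 (Real.sqrt_nonneg _)
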